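/- Two nonempty subshifts over finite alphabets are topologically conjugate if and only if their canonical symbolic matrix bisystems are properly strong shift equivalent. -/

import Mathlib

/-- The shift homeomorphism `σ` on the full shift: `(σ x) n = x (n+1)`. -/
def shiftMap {A : Type} (x : ℤ → A) : ℤ → A := fun n => x (n + 1)

/-- A subshift: a closed, shift-invariant subset of the full shift `A^ℤ`
(with `A` carrying the discrete topology and `A^ℤ` the product topology). -/
def IsSubshift {A : Type} [TopologicalSpace A] (Λ : Set (ℤ → A)) : Prop :=
  IsClosed Λ ∧ shiftMap '' Λ = Λ

/-- Replace the coordinates strictly between `k` and `l` of `x` by those of `μ`. -/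
def splice {A : Type} (x : ℤ → A) (k l : ℤ) (μ : ℤ → A) : ℤ → A :=
  fun n => if k < n ∧ n < l then μ n else x n

/-- `W_{k,l}(x)`: the set of words (recorded on the coordinates strictly between `k`
and `l`) which can be inserted between `x_{(-∞,k]}` and `x_{[l,∞)}` inside `Λ`. -/
def WSet {A : Type} (Λ : Set (ℤ → A)) (k l : ℤ) (x : ℤ → A) : Set (ℤ → A) :=
  { μ | splice x k l μ ∈ Λ }
/-- Topological conjugacy of two subshifts: a shift-commuting homeomorphism. -/
def TopConj {A B : Type} [TopologicalSpace A] [TopologicalSpace B]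
    (Λ₁ : Set (ℤ → A)) (Λ₂ : Set (ℤ → B)) : Prop :=
  ∃ h : ↥Λ₁ ≃ₜ ↥Λ₂,
    ∀ (x : ℤ → A) (hx : x ∈ Λ₁) (hx' : shiftMap x ∈ Λ₁),
      (h ⟨shiftMap x, hx'⟩).1 = shiftMap (h ⟨x, hx⟩).1
/-- The underlying data of a λ-graph bisystem `(L⁻, L⁺)` over alphabets `Sm, Sp`:
common vertex sets `V l`, upward edges `Em l = E⁻_{l+1,l}` (source in `V (l+1)`,
terminal in `V l`) labeled in `Sm`, and downward edges `Ep l = E⁺_{l,l+1}`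
(source in `V l`, terminal in `V (l+1)`) labeled in `Sp`. -/
structure LGBSData (Sm Sp : Type) where
  V : ℕ → Type
  Em : ℕ → Type
  sm : ∀ l, Em l → V (l + 1)
  tm : ∀ l, Em l → V l
  lm : ∀ l, Em l → Sm
  Ep : ℕ → Type
  sp : ∀ l, Ep l → V l
  tp : ∀ l, Ep l → V (l + 1)
  lp : ∀ l, Ep l → Sp

/-- The axioms making the data `L` a λ-graph bisystem: finite nonempty vertex sets,
finitely many edges, every vertex has the required incoming and outgoing edges,
`λ⁻` is right-resolving, `λ⁺` is left-resolving, and the local property holds. -/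
structure IsLGBS {Sm Sp : Type} (L : LGBSData Sm Sp) : Prop where
  Vfin : ∀ l, Finite (L.V l)
  Vne : ∀ l, Nonempty (L.V l)
  Emfin : ∀ l, Finite (L.Em l)
  Epfin : ∀ l, Finite (L.Ep l)
  sm_surj : ∀ l, Function.Surjective (L.sm l)
  tm_surj : ∀ l, Function.Surjective (L.tm l)
  sp_surj : ∀ l, Function.Surjective (L.sp l)
  tp_surj : ∀ l, Function.Surjective (L.tp l)
  right_resolving : ∀ l (e f : L.Em l), L.sm l e = L.sm l f → L.lm l e = L.lm l f → e = f
  left_resolving : ∀ l (e f : L.Ep l), L.tp l e = L.tp l f → L.lp l e = L.lp l f → e = f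
  local_property : ∀ (l : ℕ) (u : L.V l) (v : L.V (l + 2)),
    ∃ φ : { p : L.Em l × L.Ep (l + 1) //
              L.tm l p.1 = u ∧ L.sm l p.1 = L.sp (l + 1) p.2 ∧ L.tp (l + 1) p.2 = v } ≃
          { q : L.Ep l × L.Em (l + 1) //
              L.sp l q.1 = u ∧ L.tp l q.1 = L.tm (l + 1) q.2 ∧ L.sm (l + 1) q.2 = v },
      ∀ p, L.lm l p.1.1 = L.lm (l + 1) (φ p).1.2 ∧ L.lp (l + 1) p.1.2 = L.lp l (φ p).1.1
/-- The `(k,l)`-central equivalence relation on the points of `Λ`. -/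
def cSetoid {A : Type} (Λ : Set (ℤ → A)) (k l : ℤ) : Setoid ↥Λ where
  r x y := WSet Λ k l x.1 = WSet Λ k l y.1
  iseqv := ⟨fun _ => rfl, Eq.symm, Eq.trans⟩

/-- Powers of the shift: `(shiftZ t x) n = x (n + t)`. -/
def shiftZ {A : Type} (t : ℤ) (x : ℤ → A) : ℤ → A := fun n => x (n + t)

/-- The vertex set `V_l = Ω^c_{-l,1}` of the canonical λ-graph bisystem of `Λ`. -/
abbrev Vq {A : Type} (Λ : Set (ℤ → A)) (l : ℕ) : Type := Quotient (cSetoid Λ (-(l : ℤ)) 1)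

/-- The relation defining the labeled edges of the canonical `L_Λ⁻`: there is an edge
labeled `β` from the class `c'` (at level `l+1`) down to the class `c` (at level `l`)
iff `C' β ⊆ C`, i.e. inserting `β` (followed by a suitable word) just after
coordinate `-(l+1)` of a representative of `c'` produces a point of the class `c`. -/
def minusRel {A : Type} (Λ : Set (ℤ → A)) (l : ℕ) (β : A)
    (c' : Vq Λ (l + 1)) (c : Vq Λ l) : Prop :=
  ∃ y : ↥Λ, Quotient.mk (cSetoid Λ (-((l + 1 : ℕ) : ℤ)) 1) y = c' ∧
    ∃ (v : ℤ → A) (h : splice y.1 (-((l + 1 : ℕ) : ℤ)) 1 v ∈ Λ),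
      v (-(l : ℤ)) = β ∧
      Quotient.mk (cSetoid Λ (-(l : ℤ)) 1) ⟨splice y.1 (-((l + 1 : ℕ) : ℤ)) 1 v, h⟩ = c

/-- The relation defining the labeled edges of the canonical `L_Λ⁺`: there is an edge
labeled `α` from the class `c` (at level `l`) to the class `c'` (at level `l+1`) iff
`α C' ⊆ C`, i.e. (after the identification `Ω^c_{-(l+1),1} ≅ Ω^c_{-1,l+1}` given by
`σ^{-l}`) inserting a suitable word ending with `α` just before coordinate `l+1` of a
representative of `c'` produces (after shifting back by `σ^{l-1}`) a point of `c`. -/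
def plusRel {A : Type} (Λ : Set (ℤ → A)) (l : ℕ) (α : A)
    (c : Vq Λ l) (c' : Vq Λ (l + 1)) : Prop :=
  ∃ y : ↥Λ, Quotient.mk (cSetoid Λ (-((l + 1 : ℕ) : ℤ)) 1) y = c' ∧
    ∃ (v : ℤ → A) (h : splice (shiftZ (-(l : ℤ)) y.1) (-1) ((l : ℤ) + 1) v ∈ Λ),
      v (l : ℤ) = α ∧
      ∃ h2 : shiftZ ((l : ℤ) - 1) (splice (shiftZ (-(l : ℤ)) y.1) (-1) ((l : ℤ) + 1) v) ∈ Λ,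
        Quotient.mk (cSetoid Λ (-(l : ℤ)) 1)
          ⟨shiftZ ((l : ℤ) - 1) (splice (shiftZ (-(l : ℤ)) y.1) (-1) ((l : ℤ) + 1) v), h2⟩ = c

/-- The data of the canonical λ-graph bisystem `(L_Λ⁻, L_Λ⁺)` of a subshift `Λ`,
built from the central equivalence classes of `Λ`. -/
def canonicalLGBS {A : Type} (Λ : Set (ℤ → A)) : LGBSData A A where
  V := fun l => Vq Λ l
  Em := fun l => { p : Vq Λ (l + 1) × A × Vq Λ l // minusRel Λ l p.2.1 p.1 p.2.2 }
  sm := fun _ e => e.1.1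
  tm := fun _ e => e.1.2.2
  lm := fun _ e => e.1.2.1
  Ep := fun l => { p : Vq Λ l × A × Vq Λ (l + 1) // plusRel Λ l p.2.1 p.1 p.2.2 }
  sp := fun _ e => e.1.1
  tp := fun _ e => e.1.2.2
  lp := fun _ e => e.1.2.1
/-- Product of two symbolic matrices: the entries of the product of a symbolic matrix
over `C` and a symbolic matrix over `D` are formal sums (multisets) of two-letter
words in `C·D`. -/
def symMul {I J K C D : Type} [Fintype J]
    (A : I → J → Multiset C) (B : J → K → Multiset D) : I → K → Multiset (C × D) :=
  fun i k => ∑ j : J, (A i j).bind fun a => (B j k).map fun b => (a, b)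
/-- The underlying data of a symbolic matrix bisystem: sequences of `m l × m (l+1)`
symbolic matrices (entries are formal sums, i.e. multisets, of symbols). -/
structure SMBData (Sm Sp : Type) where
  m : ℕ → ℕ
  Mm : ∀ l, Fin (m l) → Fin (m (l + 1)) → Multiset Sm
  Mp : ∀ l, Fin (m l) → Fin (m (l + 1)) → Multiset Sp

/-- The axioms making the data `M` a symbolic matrix bisystem: nonzero rows and
columns, no repeated symbol in an entry, no symbol repeated across the rows of a
column (right/left resolving), and the κ-commutation relation
`M⁻_{l,l+1} M⁺_{l+1,l+2} ≃_κ M⁺_{l,l+1} M⁻_{l+1,l+2}`. -/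
structure IsSMB {Sm Sp : Type} (M : SMBData Sm Sp) : Prop where
  mpos : ∀ l, 0 < M.m l
  row_m : ∀ l i, ∃ j, M.Mm l i j ≠ 0
  col_m : ∀ l j, ∃ i, M.Mm l i j ≠ 0
  row_p : ∀ l i, ∃ j, M.Mp l i j ≠ 0
  col_p : ∀ l j, ∃ i, M.Mp l i j ≠ 0
  nodup_m : ∀ l i j, (M.Mm l i j).Nodup
  nodup_p : ∀ l i j, (M.Mp l i j).Nodup
  res_m : ∀ l j i i' a, a ∈ M.Mm l i j → a ∈ M.Mm l i' j → i = i'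
  res_p : ∀ l j i i' a, a ∈ M.Mp l i j → a ∈ M.Mp l i' j → i = i'
  commute : ∀ l i j,
    (symMul (M.Mm l) (M.Mp (l + 1)) i j).map Prod.swap = symMul (M.Mp l) (M.Mm (l + 1)) i j

/-- Entries of the product of `k` consecutive symbolic matrices starting at level `n`:
formal sums of words of length `k`. -/
def prodFrom {S : Type} {m : ℕ → ℕ}
    (M : ∀ l, Fin (m l) → Fin (m (l + 1)) → Multiset S) (n : ℕ) :
    (k : ℕ) → Fin (m n) → Fin (m (n + k)) → Multiset (List S)
  | 0, i, j => if i = j then {[]} else 0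
  | k + 1, i, j =>
      ∑ p : Fin (m (n + k)),
        (prodFrom M n k i p).bind fun w => (M (n + k) p j).map fun a => w ++ [a]

/-- FPCC for a symbolic matrix bisystem over a common alphabet: it is standard
(`m 0 = 1`) and for every `l ≥ 1` the words appearing in the `(1,j)` entry of
`M⁻_{0,1}⋯M⁻_{l-1,l}` are exactly the reversed words appearing in the `(1,j)` entry
of `M⁺_{0,1}⋯M⁺_{l-1,l}`. -/
def SMBData.FPCC {S : Type} (M : SMBData S S) : Prop :=
  M.m 0 = 1 ∧
  ∀ l : ℕ, 1 ≤ l → ∀ (i : Fin (M.m 0)) (j : Fin (M.m (0 + l))) (w : List S),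
    w ∈ prodFrom M.Mm 0 l i j ↔ w.reverse ∈ prodFrom M.Mp 0 l i j

/-- The set of nonempty admissible words of the presenting subshift of a symbolic
matrix bisystem: the words appearing as entries of products
`M⁺_{l,l+1} M⁺_{l+1,l+2} ⋯ M⁺_{l+k-1,l+k}`. -/
def smbWords {S : Type} (M : SMBData S S) : Set (List S) :=
  { w | w ≠ [] ∧ ∃ (n k : ℕ) (i : Fin (M.m n)) (j : Fin (M.m (n + k))),
      w ∈ prodFrom M.Mp n k i j }
/-- `M` is a matrix presentation of the λ-graph bisystem `L`: under some enumerations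
of the vertex sets, the entry `M⁻_{l,l+1}(i,j)` is the formal sum of the labels of
the `E⁻_{l+1,l}`-edges from `v_j^{l+1}` to `v_i^l`, and `M⁺_{l,l+1}(i,j)` the formal
sum of the labels of the `E⁺_{l,l+1}`-edges from `v_i^l` to `v_j^{l+1}`. -/
def Presents {S : Type} (M : SMBData S S) (L : LGBSData S S) : Prop :=
  ∃ e : ∀ l, L.V l ≃ Fin (M.m l),
    (∀ l (i : Fin (M.m l)) (j : Fin (M.m (l + 1))),
      (M.Mm l i j).Nodup ∧
      ∀ a : S, a ∈ M.Mm l i j ↔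
        ∃ ed : L.Em l, L.sm l ed = (e (l + 1)).symm j ∧ L.tm l ed = (e l).symm i ∧
          L.lm l ed = a) ∧
    (∀ l (i : Fin (M.m l)) (j : Fin (M.m (l + 1))),
      (M.Mp l i j).Nodup ∧
      ∀ a : S, a ∈ M.Mp l i j ↔
        ∃ ed : L.Ep l, L.sp l ed = (e l).symm i ∧ L.tp l ed = (e (l + 1)).symm j ∧
          L.lp l ed = a)
/-- The data of a properly strong shift equivalence in 1-step between two symbolic
matrix bisystems `M` (over `Σ_M`) and `N` (over `Σ_N`), with alphabets `C, D`,
specifications `φ : Σ_M → C·D`, `ψ : Σ_N → D·C`, and matrices `P_l` over `C`, `Q_l`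
over `D`, `X_l` over `D` and `Y_l` over `C` (the parity-dependent families `X, Y`
are recorded as `Xe l = X_{2l}`, `Xo l = X_{2l+1}`, `Ye l = Y_{2l}`, `Yo l = Y_{2l+1}`),
subject to the defining specified equivalences. -/
structure PSSE1Data (C D : Type) {SM SN : Type} (M : SMBData SM SM) (N : SMBData SN SN) where
  φ : SM → C × D
  ψ : SN → D × C
  φ_inj : Function.Injective φ
  ψ_inj : Function.Injective ψ
  c : ℕ → ℕ
  d : ℕ → ℕ
  hc : ∀ l, c (2 * l) = M.m l
  hd : ∀ l, d (2 * l) = N.m l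
  P : ∀ l, Fin (c l) → Fin (d (l + 1)) → Multiset C
  Q : ∀ l, Fin (d l) → Fin (c (l + 1)) → Multiset D
  Xe : ∀ l, Fin (c (2 * l)) → Fin (c (2 * l + 1)) → Multiset D
  Xo : ∀ l, Fin (d (2 * l + 1)) → Fin (d (2 * l + 2)) → Multiset D
  Ye : ∀ l, Fin (d (2 * l)) → Fin (d (2 * l + 1)) → Multiset C
  Yo : ∀ l, Fin (c (2 * l + 1)) → Fin (c (2 * l + 2)) → Multiset C
  hMp : ∀ l i j, (M.Mp l i j).map φ =
    symMul (P (2 * l)) (Q (2 * l + 1)) (Fin.cast (hc l).symm i) (Fin.cast (hc (l + 1)).symm j)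
  hNp : ∀ l i j, (N.Mp l i j).map ψ =
    symMul (Q (2 * l)) (P (2 * l + 1)) (Fin.cast (hd l).symm i) (Fin.cast (hd (l + 1)).symm j)
  hMm : ∀ l i j, (M.Mm l i j).map (Prod.swap ∘ φ) =
    symMul (Xe l) (Yo l) (Fin.cast (hc l).symm i) (Fin.cast (hc (l + 1)).symm j)
  hNm : ∀ l i j, (N.Mm l i j).map (Prod.swap ∘ ψ) =
    symMul (Ye l) (Xo l) (Fin.cast (hd l).symm i) (Fin.cast (hd (l + 1)).symm j)
  hYP : ∀ l i j, (symMul (Yo l) (P (2 * l + 2)) i j).map Prod.swap =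
    symMul (P (2 * l + 1)) (Ye (l + 1)) i j
  hXQ : ∀ l i j, (symMul (Xo l) (Q (2 * l + 2)) i j).map Prod.swap =
    symMul (Q (2 * l + 1)) (Xe (l + 1)) i j
  hXP : ∀ l i j, (symMul (Xe l) (P (2 * l + 1)) i j).map Prod.swap =
    symMul (P (2 * l)) (Xo l) i j
  hYQ : ∀ l i j, (symMul (Ye l) (Q (2 * l + 1)) i j).map Prod.swap =
    symMul (Q (2 * l)) (Yo l) i j

/-- Properly strong shift equivalence in 1-step. -/
def PSSE1 {SM SN : Type} (M : SMBData SM SM) (N : SMBData SN SN) : Prop :=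
  ∃ C D : Type, Nonempty (PSSE1Data C D M N)
/-- A symbolic matrix bisystem over a common alphabet, satisfying FPCC (bundled). -/
structure SMBBundle : Type 1 where
  carrier : Type
  data : SMBData carrier carrier
  isSMB : IsSMB data
  fpcc : data.FPCC

/-- Properly strong shift equivalence: a finite chain of symbolic matrix bisystems
each consecutive pair of which is properly strong shift equivalent in 1-step. -/
def ProperlySSE (b b' : SMBBundle) : Prop :=
  Relation.ReflTransGen (fun u v : SMBBundle => PSSE1 u.data v.data) b b'


def readWord {S : Type} (x : ℤ → S) : ℤ → ℕ → List S
  | _, 0 => []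
  | a, n + 1 => x a :: readWord x (a + 1) n

theorem length_readWord {S : Type} (x : ℤ → S) (a : ℤ) (n : ℕ) :
    (readWord x a n).length = n := by
  induction n generalizing a with
  | zero => rfl
  | succ n ih => simp [readWord, ih]

theorem readWord_succ' {S : Type} (x : ℤ → S) (a : ℤ) (n : ℕ) :
    readWord x a (n + 1) = readWord x a n ++ [x (a + n)] := by
  induction n generalizing a with
  | zero => simp [readWord]
  | succ n ih =>
    rw [readWord, ih (a + 1)]
    simp only [readWord, List.cons_append]
    congr 4
    push_cast
    ring

theorem readWord_eq_iff {S : Type} (x y : ℤ → S) (a b : ℤ) (n : ℕ) :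
    readWord x a n = readWord y b n ↔ ∀ k : ℕ, k < n → x (a + k) = y (b + k) := by
  induction n with
  | zero => simp [readWord]
  | succ n ih =>
    rw [readWord_succ', readWord_succ']
    constructor
    · intro h k hk
      obtain ⟨h1, h2⟩ := List.append_inj' h rfl
      rcases Nat.lt_succ_iff_lt_or_eq.1 hk with hk | rfl
      · exact ih.1 h1 k hk
      · simpa using h2
    · intro h
      rw [ih.2 fun k hk => h k (by omega), h n (by omega)]

theorem readWord_shiftZ {S : Type} (t : ℤ) (x : ℤ → S) (a : ℤ) (n : ℕ) :
    readWord (shiftZ t x) a n = readWord x (a + t) n := by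
  rw [readWord_eq_iff]
  intro k _
  simp only [shiftZ]
  congr 1
  ring

/-- Invariance of a set of sequences under the shift by `t`. -/
def ShiftInv {S : Type} (t : ℤ) (K : Set (ℤ → S)) : Prop :=
  ∀ z, shiftZ t z ∈ K ↔ z ∈ K

/-- Two sequences agree outside the window `[a, a + n)`. -/
def AgreeOff {S : Type} (x y : ℤ → S) (a : ℤ) (n : ℕ) : Prop :=
  ∀ m : ℤ, m < a ∨ a + n ≤ m → x m = y m

/-- The words which can be inserted into `z` on the window `[a, a + n)` inside `K`. -/
def fillings {S : Type} (K : Set (ℤ → S)) (z : ℤ → S) (a : ℤ) (n : ℕ) : Set (List S) :=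
  {w | ∃ z' ∈ K, AgreeOff z' z a n ∧ readWord z' a n = w}

/-- The sets of fillings of the window `[a, a + n)` in points of `K`; they stand for the
central equivalence classes. -/
def centralClasses {S : Type} (K : Set (ℤ → S)) (a : ℤ) (n : ℕ) : Set (Set (List S)) :=
  {W | ∃ z ∈ K, W = fillings K z a n}

/-- Left quotient of a set of words by a letter. -/
def lq {S : Type} (s : S) (W : Set (List S)) : Set (List S) := {w | s :: w ∈ W}

/-- Right quotient of a set of words by a letter. -/
def rq {S : Type} (s : S) (W : Set (List S)) : Set (List S) := {w | w ++ [s] ∈ W}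

theorem lq_rq {S : Type} (s t : S) (W : Set (List S)) : lq s (rq t W) = rq t (lq s W) := rfl

theorem nonempty_of_lq {S : Type} (s : S) (W : Set (List S)) (h : (lq s W).Nonempty) :
    W.Nonempty :=
  h.elim fun w hw => ⟨s :: w, hw⟩

theorem nonempty_of_rq {S : Type} (s : S) (W : Set (List S)) (h : (rq s W).Nonempty) :
    W.Nonempty :=
  h.elim fun w hw => ⟨w ++ [s], hw⟩

theorem AgreeOff.refl {S : Type} (x : ℤ → S) (a : ℤ) (n : ℕ) : AgreeOff x x a n :=
  fun _ _ => rfl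

theorem AgreeOff.symm {S : Type} {x y : ℤ → S} {a : ℤ} {n : ℕ} (h : AgreeOff x y a n) :
    AgreeOff y x a n :=
  fun m hm => (h m hm).symm

theorem readWord_mem_fillings {S : Type} {K : Set (ℤ → S)} {z : ℤ → S} (hz : z ∈ K) (a : ℤ)
    (n : ℕ) : readWord z a n ∈ fillings K z a n :=
  ⟨z, hz, AgreeOff.refl z a n, rfl⟩

theorem lq_fillings {S : Type} (K : Set (ℤ → S)) {z z₀ : ℤ → S} {a : ℤ} {n : ℕ}
    (h : AgreeOff z₀ z a (n + 1)) :
    lq (z₀ a) (fillings K z a (n + 1)) = fillings K z₀ (a + 1) n := by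
  ext w
  constructor
  · rintro ⟨z', hz', hag, hr⟩
    obtain ⟨h1, h2⟩ := List.cons.inj hr
    refine ⟨z', hz', fun m hm => ?_, h2⟩
    by_cases hma : m = a
    · rw [hma, h1]
    · rw [hag m (by push_cast; omega), h m (by push_cast; omega)]
  · rintro ⟨z', hz', hag, hr⟩
    refine ⟨z', hz', fun m hm => ?_, ?_⟩
    · rw [hag m (by push_cast at hm; omega), h m hm]
    · rw [readWord, hr, hag a (by omega)]

theorem rq_fillings {S : Type} (K : Set (ℤ → S)) {z z₀ : ℤ → S} {a : ℤ} {n : ℕ}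
    (h : AgreeOff z₀ z a (n + 1)) :
    rq (z₀ (a + n)) (fillings K z a (n + 1)) = fillings K z₀ a n := by
  ext w
  constructor
  · rintro ⟨z', hz', hag, hr⟩
    rw [readWord_succ'] at hr
    obtain ⟨h1, h2⟩ := List.append_inj' hr rfl
    refine ⟨z', hz', fun m hm => ?_, h1⟩
    by_cases hma : m = a + n
    · rw [hma]
      simpa using h2
    · rw [hag m (by push_cast; omega), h m (by push_cast; omega)]
  · rintro ⟨z', hz', hag, hr⟩
    refine ⟨z', hz', fun m hm => ?_, ?_⟩
    · rw [hag m (by push_cast at hm; omega), h m hm]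
    · rw [readWord_succ', hr, hag (a + n) (by omega)]

/-- The quotients by letters of the sets in `𝒲` belong to `𝒱` unless they are empty. -/
def QuotClosed {E : Type} (op : E → Set (List E) → Set (List E)) (𝒱 𝒲 : Set (Set (List E))) :
    Prop :=
  ∀ W ∈ 𝒲, ∀ s, (op s W).Nonempty → op s W ∈ 𝒱

theorem quotClosed_lq {S : Type} (K : Set (ℤ → S)) (a : ℤ) (n : ℕ) :
    QuotClosed lq (centralClasses K (a + 1) n) (centralClasses K a (n + 1)) := by
  rintro W ⟨z, hz, rfl⟩ s ⟨w, z₀, hz₀, hag, hr⟩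
  obtain ⟨rfl, -⟩ := List.cons.inj hr
  exact ⟨z₀, hz₀, lq_fillings K hag⟩

theorem quotClosed_rq {S : Type} (K : Set (ℤ → S)) (a : ℤ) (n : ℕ) :
    QuotClosed rq (centralClasses K a n) (centralClasses K a (n + 1)) := by
  rintro W ⟨z, hz, rfl⟩ s ⟨w, z₀, hz₀, hag, hr⟩
  rw [readWord_succ'] at hr
  obtain ⟨-, h2⟩ := List.append_inj' hr rfl
  obtain rfl : z₀ (a + n) = s := by simpa using h2
  exact ⟨z₀, hz₀, rq_fillings K hag⟩

theorem nonempty_of_mem_centralClasses {S : Type} {K : Set (ℤ → S)} {a : ℤ} {n : ℕ}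
    {W : Set (List S)} (h : W ∈ centralClasses K a n) : W.Nonempty := by
  obtain ⟨z, hz, rfl⟩ := h
  exact ⟨_, readWord_mem_fillings hz a n⟩

theorem length_of_mem_centralClasses {S : Type} {K : Set (ℤ → S)} {a : ℤ} {n : ℕ}
    {W : Set (List S)} (h : W ∈ centralClasses K a n) {w : List S} (hw : w ∈ W) :
    w.length = n := by
  obtain ⟨z, hz, rfl⟩ := h
  obtain ⟨z', -, -, rfl⟩ := hw
  exact length_readWord z' a n

theorem finite_centralClasses {S : Type} [Finite S] (K : Set (ℤ → S)) (a : ℤ) (n : ℕ) :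
    (centralClasses K a n).Finite := by
  refine ((List.finite_length_eq S n).powerset).subset fun W hW w hw => ?_
  exact length_of_mem_centralClasses hW hw

theorem agreeOff_shiftZ {S : Type} (t : ℤ) (x y : ℤ → S) (a : ℤ) (n : ℕ) :
    AgreeOff (shiftZ t x) (shiftZ t y) a n ↔ AgreeOff x y (a + t) n := by
  constructor
  · intro h m hm
    have := h (m - t) (by omega)
    simpa [shiftZ] using this
  · intro h m hm
    exact h (m + t) (by omega)

theorem shiftZ_shiftZ {S : Type} (s t : ℤ) (x : ℤ → S) :
    shiftZ s (shiftZ t x) = shiftZ (s + t) x := by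
  funext n
  simp [shiftZ, add_assoc]

theorem shiftZ_zero {S : Type} (x : ℤ → S) : shiftZ 0 x = x := by
  funext n
  simp [shiftZ]

theorem ShiftInv.neg {S : Type} {t : ℤ} {K : Set (ℤ → S)} (h : ShiftInv t K) :
    ShiftInv (-t) K := by
  intro z
  rw [← h, shiftZ_shiftZ, add_neg_cancel, shiftZ_zero]

theorem ShiftInv.mul {S : Type} {t : ℤ} {K : Set (ℤ → S)} (h : ShiftInv t K) (k : ℤ) :
    ShiftInv (k * t) K := by
  have key : ∀ (u : ℤ), ShiftInv u K → ∀ n : ℕ, ShiftInv (n * u) K := by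
    intro u hu n
    induction n with
    | zero => intro z; simp [shiftZ_zero]
    | succ n ih =>
      intro z
      rw [Nat.cast_succ, add_mul, one_mul, add_comm, ← shiftZ_shiftZ, hu, ih]
  obtain ⟨n, rfl | rfl⟩ := k.eq_nat_or_neg
  · exact key t h n
  · have := key (-t) h.neg n
    rwa [mul_neg, ← neg_mul] at this

theorem ShiftInv.all {S : Type} {K : Set (ℤ → S)} (h : ShiftInv 1 K) (k : ℤ) : ShiftInv k K := by
  simpa using h.mul k

theorem fillings_shiftZ {S : Type} {t : ℤ} {K : Set (ℤ → S)} (h : ShiftInv t K) (z : ℤ → S)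
    (a : ℤ) (n : ℕ) : fillings K (shiftZ t z) a n = fillings K z (a + t) n := by
  ext w
  constructor
  · rintro ⟨z', hz', hag, rfl⟩
    have hz : shiftZ t (shiftZ (-t) z') = z' := by
      rw [shiftZ_shiftZ, add_neg_cancel, shiftZ_zero]
    rw [← hz] at hz' hag ⊢
    exact ⟨_, (h _).1 hz', (agreeOff_shiftZ ..).1 hag, (readWord_shiftZ ..).symm⟩
  · rintro ⟨z', hz', hag, rfl⟩
    exact ⟨shiftZ t z', (h _).2 hz', (agreeOff_shiftZ ..).2 hag, readWord_shiftZ ..⟩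

theorem centralClasses_add {S : Type} {t : ℤ} {K : Set (ℤ → S)} (h : ShiftInv t K) (a : ℤ)
    (n : ℕ) : centralClasses K (a + t) n = centralClasses K a n := by
  ext W
  constructor
  · rintro ⟨z, hz, rfl⟩
    exact ⟨shiftZ t z, (h _).2 hz, (fillings_shiftZ h ..).symm⟩
  · rintro ⟨z, hz, rfl⟩
    refine ⟨shiftZ (-t) z, (h.neg _).2 hz, ?_⟩
    rw [fillings_shiftZ h.neg, add_neg_cancel_right]

theorem centralClasses_congr {S : Type} {K : Set (ℤ → S)} (h : ShiftInv 1 K) (a b : ℤ)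
    (n : ℕ) : centralClasses K a n = centralClasses K b n := by
  simpa using (centralClasses_add (h.all (a - b)) b n)

/-! ### Symbolic matrices defined by quotients -/

/-- The entries of `M` list the letters `s` with `u i = op s (v j)`. -/
def IsQuotMat {E I J : Type} (op : E → Set (List E) → Set (List E)) (u : I → Set (List E))
    (v : J → Set (List E)) (M : I → J → Multiset E) : Prop :=
  (∀ i j, (M i j).Nodup) ∧ ∀ i j s, s ∈ M i j ↔ u i = op s (v j)

theorem exists_isQuotMat {E I J : Type} [Finite E] (op : E → Set (List E) → Set (List E))
    (u : I → Set (List E)) (v : J → Set (List E)) :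
    ∃ M : I → J → Multiset E, IsQuotMat op u v M :=
  ⟨fun i j => (Set.toFinite {s | u i = op s (v j)}).toFinset.val,
    fun _ _ => Finset.nodup _, fun i j s => by simp⟩

/-- An injective enumeration of a family of sets of words. -/
def Enumerates {E I : Type} (u : I → Set (List E)) (𝒱 : Set (Set (List E))) : Prop :=
  Function.Injective u ∧ Set.range u = 𝒱

theorem Enumerates.mem {E I : Type} {u : I → Set (List E)} {𝒱 : Set (Set (List E))}
    (h : Enumerates u 𝒱) (i : I) : u i ∈ 𝒱 :=
  h.2 ▸ Set.mem_range_self i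

theorem Enumerates.exists {E I : Type} {u : I → Set (List E)} {𝒱 : Set (Set (List E))}
    (h : Enumerates u 𝒱) {W : Set (List E)} (hW : W ∈ 𝒱) : ∃ i, u i = W := by
  rwa [← h.2] at hW

theorem mem_symMul {I J K C D : Type} [Fintype J] (A : I → J → Multiset C)
    (B : J → K → Multiset D) (i : I) (k : K) (p : C × D) :
    p ∈ symMul A B i k ↔ ∃ j, p.1 ∈ A i j ∧ p.2 ∈ B j k := by
  simp only [symMul, Multiset.mem_sum, Multiset.mem_bind, Multiset.mem_map, Finset.mem_univ,
    true_and]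
  constructor
  · rintro ⟨j, a, ha, b, hb, rfl⟩
    exact ⟨j, ha, hb⟩
  · rintro ⟨j, ha, hb⟩
    exact ⟨j, p.1, ha, p.2, hb, rfl⟩

theorem nodup_symMul {I J K C D : Type} [Fintype J] {A : I → J → Multiset C}
    {B : J → K → Multiset D} (hA : ∀ i j, (A i j).Nodup) (hB : ∀ j k, (B j k).Nodup)
    (hres : ∀ j j' k b, b ∈ B j k → b ∈ B j' k → j = j') (i : I) (k : K) :
    (symMul A B i k).Nodup := by
  have : symMul A B i k = (Finset.univ.val : Multiset J).bind fun j => A i j ×ˢ B j k := rfl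
  rw [this, Multiset.nodup_bind]
  refine ⟨fun j _ => (hA i j).product (hB j k), ?_⟩
  refine Multiset.Nodup.pairwise (fun j _ j' _ hne => ?_) Finset.univ.nodup
  rw [Function.onFun, Multiset.disjoint_left]
  rintro ⟨a, b⟩ h h'
  rw [Multiset.mem_product] at h h'
  exact hne (hres _ _ _ _ h.2 h'.2)

theorem IsQuotMat.resolving {E J K : Type} {op : E → Set (List E) → Set (List E)}
    {v : J → Set (List E)} {w : K → Set (List E)} {B : J → K → Multiset E}
    (hB : IsQuotMat op v w B) (hv : Function.Injective v) (j j' : J)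
    (k : K) (b : E) (h : b ∈ B j k) (h' : b ∈ B j' k) : j = j' := by
  rw [hB.2] at h h'
  exact hv (h.trans h'.symm)

section QuotProducts

variable {E I J K : Type} [Fintype J] {op₁ op₂ : E → Set (List E) → Set (List E)}
  {𝒰 𝒱 𝒲 : Set (Set (List E))} {u : I → Set (List E)} {v : J → Set (List E)}
  {w : K → Set (List E)} {A : I → J → Multiset E} {B : J → K → Multiset E}

theorem IsQuotMat.mem_symMul (hA : IsQuotMat op₁ u v A) (hB : IsQuotMat op₂ v w B)
    (hne : ∀ i, (u i).Nonempty) (hv : Enumerates v 𝒱) (hw : Enumerates w 𝒲)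
    (hcl : QuotClosed op₂ 𝒱 𝒲) (hop : ∀ s W, (op₁ s W).Nonempty → W.Nonempty)
    (i : I) (k : K) (p : E × E) :
    p ∈ symMul A B i k ↔ u i = op₁ p.1 (op₂ p.2 (w k)) := by
  rw [_root_.mem_symMul]
  constructor
  · rintro ⟨j, h1, h2⟩
    rw [hA.2] at h1
    rw [hB.2] at h2
    rw [h1, h2]
  · intro h
    obtain ⟨j, hj⟩ := hv.exists (hcl _ (hw.mem k) p.2 (hop p.1 _ (h ▸ hne i)))
    exact ⟨j, (hA.2 ..).2 (by rw [h, hj]), (hB.2 ..).2 hj⟩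

theorem IsQuotMat.nodup_symMul (hA : IsQuotMat op₁ u v A) (hB : IsQuotMat op₂ v w B)
    (hv : Enumerates v 𝒱) (i : I) (k : K) : (symMul A B i k).Nodup :=
  _root_.nodup_symMul hA.1 hB.1 (hB.resolving hv.1) i k

theorem IsQuotMat.symMul_swap {J' : Type} [Fintype J'] {v' : J' → Set (List E)}
    {𝒱' : Set (Set (List E))} {A' : J' → K → Multiset E} {B' : I → J' → Multiset E}
    (hA : IsQuotMat op₁ u v A) (hB : IsQuotMat op₂ v w B)
    (hB' : IsQuotMat op₂ u v' B') (hA' : IsQuotMat op₁ v' w A')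
    (hne : ∀ i, (u i).Nonempty) (hv : Enumerates v 𝒱) (hv' : Enumerates v' 𝒱')
    (hw : Enumerates w 𝒲) (hcl : QuotClosed op₂ 𝒱 𝒲) (hcl' : QuotClosed op₁ 𝒱' 𝒲)
    (hop₁ : ∀ s W, (op₁ s W).Nonempty → W.Nonempty)
    (hop₂ : ∀ s W, (op₂ s W).Nonempty → W.Nonempty)
    (hcomm : ∀ s t W, op₁ s (op₂ t W) = op₂ t (op₁ s W)) (i : I) (k : K) :
    (symMul A B i k).map Prod.swap = symMul B' A' i k := by
  rw [Multiset.Nodup.ext ((hA.nodup_symMul hB hv i k).map Prod.swap_injective)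
    (hB'.nodup_symMul hA' hv' i k)]
  intro p
  rw [hB'.mem_symMul hA' hne hv' hw hcl' hop₂, ← hcomm, Multiset.mem_map]
  constructor
  · rintro ⟨q, hq, rfl⟩
    exact (hA.mem_symMul hB hne hv hw hcl hop₁ i k q).1 hq
  · intro h
    exact ⟨p.swap, (hA.mem_symMul hB hne hv hw hcl hop₁ i k p.swap).2 h, p.swap_swap⟩

end QuotProducts

/-! ### Matrix bisystems given by central classes -/

/-- `M` is the symbolic matrix bisystem of quotients between the central classes of `Λ`,
enumerated by `e`. -/
structure IsClassPresentation {S : Type} (Λ : Set (ℤ → S)) (M : SMBData S S)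
    (e : ∀ l, Fin (M.m l) → Set (List S)) : Prop where
  enum : ∀ l, Enumerates (e l) (centralClasses Λ 0 l)
  minus : ∀ l, IsQuotMat lq (e l) (e (l + 1)) (M.Mm l)
  plus : ∀ l, IsQuotMat rq (e l) (e (l + 1)) (M.Mp l)

theorem exists_isClassPresentation {S : Type} [Finite S] (Λ : Set (ℤ → S)) :
    ∃ (M : SMBData S S) (e : ∀ l, Fin (M.m l) → Set (List S)), IsClassPresentation Λ M e := by
  classical
  have hfin := fun l : ℕ => finite_centralClasses Λ 0 l
  have hfin' : ∀ l : ℕ, Finite (centralClasses Λ 0 l) := fun l => (hfin l).to_subtype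
  choose Mm hMm using fun l : ℕ => exists_isQuotMat lq
    (fun i => ((Finite.equivFin (centralClasses Λ 0 l)).symm i).1)
    (fun i => ((Finite.equivFin (centralClasses Λ 0 (l + 1))).symm i).1)
  choose Mp hMp using fun l : ℕ => exists_isQuotMat rq
    (fun i => ((Finite.equivFin (centralClasses Λ 0 l)).symm i).1)
    (fun i => ((Finite.equivFin (centralClasses Λ 0 (l + 1))).symm i).1)
  refine ⟨⟨fun l => Nat.card (centralClasses Λ 0 l), Mm, Mp⟩,
    fun l i => ((Finite.equivFin (centralClasses Λ 0 l)).symm i).1, ⟨fun l => ⟨?_, ?_⟩, hMm, hMp⟩⟩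
  · exact Subtype.val_injective.comp (Equiv.injective _)
  · ext W
    constructor
    · rintro ⟨i, rfl⟩
      exact Subtype.coe_prop _
    · intro hW
      exact ⟨Finite.equivFin _ ⟨W, hW⟩, congrArg Subtype.val (Equiv.symm_apply_apply _ _)⟩

section ClassPresentation

variable {S : Type} {Λ : Set (ℤ → S)} {M : SMBData S S} {e : ∀ l, Fin (M.m l) → Set (List S)}

theorem IsClassPresentation.nonempty (h : IsClassPresentation Λ M e) (l : ℕ) (i : Fin (M.m l)) :
    (e l i).Nonempty :=
  nonempty_of_mem_centralClasses ((h.enum l).mem i)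

theorem IsClassPresentation.quotClosed_lq (hΛ : ShiftInv 1 Λ) (l : ℕ) :
    QuotClosed lq (centralClasses Λ 0 l) (centralClasses Λ 0 (l + 1)) := by
  rw [centralClasses_congr hΛ 0 (0 + 1) l]
  exact _root_.quotClosed_lq Λ 0 l

theorem IsClassPresentation.isSMB (h : IsClassPresentation Λ M e) (hΛ : ShiftInv 1 Λ)
    (hne : Λ.Nonempty) : IsSMB M where
  mpos l := by
    obtain ⟨z, hz⟩ := hne
    obtain ⟨i, -⟩ := (h.enum l).exists ⟨z, hz, rfl⟩
    exact i.pos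
  row_m l i := by
    have hi := (h.enum l).mem i
    rw [centralClasses_congr hΛ 0 (0 + 1) l] at hi
    obtain ⟨z, hz, hzi⟩ := hi
    obtain ⟨j, hj⟩ := (h.enum (l + 1)).exists ⟨z, hz, rfl⟩
    refine ⟨j, fun h0 => Multiset.notMem_zero (z 0) (h0 ▸ ((h.minus l).2 i j (z 0)).2 ?_)⟩
    rw [hzi, hj, lq_fillings Λ (AgreeOff.refl z 0 (l + 1))]
  col_m l j := by
    obtain ⟨z, hz, hzj⟩ := (h.enum (l + 1)).mem j
    have hq := lq_fillings Λ (AgreeOff.refl z 0 (l + 1))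
    have hmem : lq (z 0) (e (l + 1) j) ∈ centralClasses Λ 0 l := by
      rw [centralClasses_congr hΛ 0 (0 + 1) l, hzj, hq]
      exact ⟨z, hz, rfl⟩
    obtain ⟨i, hi⟩ := (h.enum l).exists hmem
    exact ⟨i, fun h0 => Multiset.notMem_zero (z 0) (h0 ▸ ((h.minus l).2 i j (z 0)).2 hi)⟩
  row_p l i := by
    obtain ⟨z, hz, hzi⟩ := (h.enum l).mem i
    obtain ⟨j, hj⟩ := (h.enum (l + 1)).exists ⟨z, hz, rfl⟩
    refine ⟨j, fun h0 =>
      Multiset.notMem_zero (z (0 + l)) (h0 ▸ ((h.plus l).2 i j (z (0 + l))).2 ?_)⟩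
    rw [hzi, hj, rq_fillings Λ (AgreeOff.refl z 0 (l + 1))]
  col_p l j := by
    obtain ⟨z, hz, hzj⟩ := (h.enum (l + 1)).mem j
    have hmem : rq (z (0 + l)) (e (l + 1) j) ∈ centralClasses Λ 0 l := by
      rw [hzj, rq_fillings Λ (AgreeOff.refl z 0 (l + 1))]
      exact ⟨z, hz, rfl⟩
    obtain ⟨i, hi⟩ := (h.enum l).exists hmem
    exact ⟨i, fun h0 =>
      Multiset.notMem_zero (z (0 + l)) (h0 ▸ ((h.plus l).2 i j (z (0 + l))).2 hi)⟩
  nodup_m l := (h.minus l).1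
  nodup_p l := (h.plus l).1
  res_m l j i i' a := (h.minus l).resolving (h.enum l).1 i i' j a
  res_p l j i i' a := (h.plus l).resolving (h.enum l).1 i i' j a
  commute l i j :=
    (h.minus l).symMul_swap (h.plus (l + 1)) (h.plus l) (h.minus (l + 1)) (h.nonempty l)
      (h.enum (l + 1)) (h.enum (l + 1)) (h.enum (l + 2)) (quotClosed_rq Λ 0 (l + 1))
      (IsClassPresentation.quotClosed_lq hΛ (l + 1)) nonempty_of_lq nonempty_of_rq lq_rq i j

theorem IsClassPresentation.mem_prodFrom_minus (h : IsClassPresentation Λ M e)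
    (hΛ : ShiftInv 1 Λ) (n k : ℕ) (i : Fin (M.m n)) (j : Fin (M.m (n + k))) (w : List S) :
    w ∈ prodFrom M.Mm n k i j ↔
      w.length = k ∧ e n i = {u | w.reverse ++ u ∈ e (n + k) j} := by
  induction k generalizing w with
  | zero =>
    simp only [prodFrom]
    split_ifs with hij
    · subst hij
      simp only [Multiset.mem_singleton, List.length_eq_zero_iff]
      constructor
      · rintro rfl
        exact ⟨rfl, rfl⟩
      · exact fun h => h.1
    · simp only [Multiset.notMem_zero, List.length_eq_zero_iff, false_iff]
      rintro ⟨rfl, hw⟩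
      exact hij ((h.enum n).1 hw)
  | succ k ih =>
    simp only [prodFrom, Multiset.mem_sum, Finset.mem_univ, true_and, Multiset.mem_bind,
      Multiset.mem_map]
    change _ ↔ _ ∧ e n i = {u | w.reverse ++ u ∈ e (n + k + 1) j}
    constructor
    · rintro ⟨p, w', hw', a, ha, rfl⟩
      obtain ⟨h1, h2⟩ := (ih p w').1 hw'
      rw [(h.minus _).2] at ha
      refine ⟨by simp [h1], ?_⟩
      rw [h2, ha]
      ext u
      simp [lq]
    · rintro ⟨h1, h2⟩
      obtain rfl | ⟨w', a, rfl⟩ := w.eq_nil_or_concat'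
      · simp at h1
      · have hne : (lq a (e (n + k + 1) j)).Nonempty := by
          obtain ⟨u, hu⟩ := h.nonempty n i
          rw [h2] at hu
          exact ⟨w'.reverse ++ u, by simpa [lq] using hu⟩
        obtain ⟨p, hp⟩ := (h.enum (n + k)).exists
          (IsClassPresentation.quotClosed_lq hΛ (n + k) _ ((h.enum (n + k + 1)).mem j) a hne)
        refine ⟨p, w', (ih p w').2 ⟨by simpa using h1, ?_⟩, a, ((h.minus _).2 ..).2 hp, rfl⟩
        rw [h2, hp]
        ext u
        simp [lq]

theorem IsClassPresentation.mem_prodFrom_plus (h : IsClassPresentation Λ M e)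
    (n k : ℕ) (i : Fin (M.m n)) (j : Fin (M.m (n + k))) (w : List S) :
    w ∈ prodFrom M.Mp n k i j ↔ w.length = k ∧ e n i = {u | u ++ w ∈ e (n + k) j} := by
  induction k generalizing w with
  | zero =>
    simp only [prodFrom]
    split_ifs with hij
    · subst hij
      simp only [Multiset.mem_singleton, List.length_eq_zero_iff]
      constructor
      · rintro rfl
        exact ⟨rfl, by simp⟩
      · exact fun h => h.1
    · simp only [Multiset.notMem_zero, List.length_eq_zero_iff, false_iff]
      rintro ⟨rfl, hw⟩
      exact hij ((h.enum n).1 (by simpa using hw))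
  | succ k ih =>
    simp only [prodFrom, Multiset.mem_sum, Finset.mem_univ, true_and, Multiset.mem_bind,
      Multiset.mem_map]
    change _ ↔ _ ∧ e n i = {u | u ++ w ∈ e (n + k + 1) j}
    constructor
    · rintro ⟨p, w', hw', a, ha, rfl⟩
      obtain ⟨h1, h2⟩ := (ih p w').1 hw'
      rw [(h.plus _).2] at ha
      refine ⟨by simp [h1], ?_⟩
      rw [h2, ha]
      ext u
      simp [rq]
    · rintro ⟨h1, h2⟩
      obtain rfl | ⟨w', a, rfl⟩ := w.eq_nil_or_concat'
      · simp at h1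
      · have hne : (rq a (e (n + k + 1) j)).Nonempty := by
          obtain ⟨u, hu⟩ := h.nonempty n i
          rw [h2] at hu
          exact ⟨u ++ w', by simpa [rq] using hu⟩
        obtain ⟨p, hp⟩ := (h.enum (n + k)).exists
          (quotClosed_rq Λ 0 (n + k) _ ((h.enum (n + k + 1)).mem j) a hne)
        refine ⟨p, w', (ih p w').2 ⟨by simpa using h1, ?_⟩, a, ((h.plus _).2 ..).2 hp, rfl⟩
        rw [h2, hp]
        ext u
        simp [rq]

theorem centralClasses_zero (hne : Λ.Nonempty) (a : ℤ) : centralClasses Λ a 0 = {{[]}} := by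
  have key : ∀ z ∈ Λ, fillings Λ z a 0 = {[]} := by
    intro z hz
    ext w
    constructor
    · rintro ⟨z', -, -, rfl⟩
      rfl
    · rintro rfl
      exact readWord_mem_fillings hz a 0
  ext W
  constructor
  · rintro ⟨z, hz, rfl⟩
    exact key z hz
  · rintro rfl
    obtain ⟨z, hz⟩ := hne
    exact ⟨z, hz, (key z hz).symm⟩

theorem IsClassPresentation.fpcc (h : IsClassPresentation Λ M e) (hΛ : ShiftInv 1 Λ)
    (hne : Λ.Nonempty) : M.FPCC := by
  have h0 : ∀ i, e 0 i = {[]} := fun i => by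
    simpa [centralClasses_zero hne] using (h.enum 0).mem i
  constructor
  · have : Subsingleton (Fin (M.m 0)) := ⟨fun i j => (h.enum 0).1 (by rw [h0, h0])⟩
    have h1 := Fin.subsingleton_iff_le_one.1 this
    have h2 := (h.isSMB hΛ hne).mpos 0
    omega
  · intro l _ i j w
    rw [h.mem_prodFrom_minus hΛ, h.mem_prodFrom_plus, h0, List.length_reverse]
    refine and_congr_right fun hw => ?_
    have hlen : ∀ u ∈ e (0 + l) j, u.length = l := fun u hu => by
      rw [length_of_mem_centralClasses ((h.enum (0 + l)).mem j) hu, zero_add]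
    have aux : ∀ u : List S, (w.reverse ++ u ∈ e (0 + l) j → u = []) ∧
        (u ++ w.reverse ∈ e (0 + l) j → u = []) := fun u =>
      ⟨fun hu => by simpa [hw] using hlen _ hu, fun hu => by simpa [hw] using hlen _ hu⟩
    constructor
    · intro hs
      have hm : ([] : List S) ∈ {u | w.reverse ++ u ∈ e (0 + l) j} := hs ▸ rfl
      ext u
      constructor
      · rintro rfl
        simpa using hm
      · exact (aux u).2
    · intro hs
      have hm : ([] : List S) ∈ {u | u ++ w.reverse ∈ e (0 + l) j} := hs ▸ rfl
      ext u
      constructor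
      · rintro rfl
        simpa using hm
      · exact (aux u).1

end ClassPresentation

/-! ### Interleaved codings and strong shift equivalence in one step -/

/-- Replace each letter `s` of a word by the two letters of `φ s`. -/
def pairs {S E : Type} (φ : S → E × E) : List S → List E
  | [] => []
  | s :: w => (φ s).1 :: (φ s).2 :: pairs φ w

theorem pairs_append {S E : Type} (φ : S → E × E) (w w' : List S) :
    pairs φ (w ++ w') = pairs φ w ++ pairs φ w' := by
  induction w with
  | nil => rfl
  | cons s w ih => simp [pairs, ih]

theorem pairs_injective {S E : Type} {φ : S → E × E} (hφ : Function.Injective φ) :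
    Function.Injective (pairs φ) := by
  intro w
  induction w with
  | nil => rintro (_ | ⟨s, w'⟩) h <;> simp_all [pairs]
  | cons s w ih =>
    rintro (_ | ⟨s', w'⟩) h
    · simp [pairs] at h
    · simp only [pairs, List.cons.injEq] at h
      rw [hφ (Prod.ext h.1 h.2.1), ih h.2.2]

theorem eq_lq_lq_pairs_iff {S E : Type} {φ : S → E × E} (hφ : Function.Injective φ)
    {V W : Set (List S)} (hV : V.Nonempty) (p : E × E) :
    pairs φ '' V = lq p.2 (lq p.1 (pairs φ '' W)) ↔ ∃ s, V = lq s W ∧ φ s = p := by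
  have key : ∀ s, lq (φ s).2 (lq (φ s).1 (pairs φ '' W)) = pairs φ '' lq s W := by
    intro s
    ext u
    constructor
    · rintro ⟨_ | ⟨s', w⟩, hw, hu⟩
      · simp [pairs] at hu
      · simp only [pairs, List.cons.injEq] at hu
        obtain rfl := hφ (Prod.ext hu.1 hu.2.1)
        exact ⟨w, hw, hu.2.2⟩
    · rintro ⟨w, hw, rfl⟩
      exact ⟨s :: w, hw, rfl⟩
  constructor
  · intro h
    obtain ⟨v, hv⟩ := hV
    have hm : pairs φ v ∈ lq p.2 (lq p.1 (pairs φ '' W)) := h ▸ Set.mem_image_of_mem _ hv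
    obtain ⟨_ | ⟨s, w⟩, hw, hu⟩ := hm
    · simp [pairs] at hu
    · simp only [pairs, List.cons.injEq] at hu
      have hp : φ s = p := Prod.ext hu.1 hu.2.1
      subst hp
      exact ⟨s, (pairs_injective hφ).image_injective (h.trans (key s)), rfl⟩
  · rintro ⟨s, rfl, rfl⟩
    exact (key s).symm

theorem eq_rq_rq_pairs_iff {S E : Type} {φ : S → E × E} (hφ : Function.Injective φ)
    {V W : Set (List S)} (hV : V.Nonempty) (p : E × E) :
    pairs φ '' V = rq p.1 (rq p.2 (pairs φ '' W)) ↔ ∃ s, V = rq s W ∧ φ s = p := by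
  have split : ∀ (w : List S) (u : List E) (p : E × E), pairs φ w = (u ++ [p.1]) ++ [p.2] →
      ∃ w' s, w = w' ++ [s] ∧ pairs φ w' = u ∧ φ s = p := by
    intro w u p h
    obtain rfl | ⟨w', s, rfl⟩ := w.eq_nil_or_concat'
    · simp [pairs] at h
    · rw [pairs_append, List.append_assoc] at h
      obtain ⟨h1, h2⟩ := List.append_inj' h rfl
      simp only [pairs, List.cons_append, List.nil_append, List.cons.injEq, and_true] at h2
      exact ⟨w', s, rfl, h1, Prod.ext h2.1 h2.2⟩
  have key : ∀ s, rq (φ s).1 (rq (φ s).2 (pairs φ '' W)) = pairs φ '' rq s W := by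
    intro s
    ext u
    constructor
    · rintro ⟨w, hw, hu⟩
      obtain ⟨w', s', rfl, rfl, hs⟩ := split w u (φ s) hu
      obtain rfl := hφ hs
      exact ⟨w', hw, rfl⟩
    · rintro ⟨w, hw, rfl⟩
      exact ⟨w ++ [s], hw, by simp [pairs_append, pairs]⟩
  constructor
  · intro h
    obtain ⟨v, hv⟩ := hV
    have hm : pairs φ v ∈ rq p.1 (rq p.2 (pairs φ '' W)) := h ▸ Set.mem_image_of_mem _ hv
    obtain ⟨w, hw, hu⟩ := hm
    obtain ⟨w', s, rfl, -, rfl⟩ := split w _ p hu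
    exact ⟨s, (pairs_injective hφ).image_injective (h.trans (key s)), rfl⟩
  · rintro ⟨s, rfl, rfl⟩
    exact (key s).symm

/-- `z` is obtained from `x` by writing `φ (x n)` at the positions `2 n + o, 2 n + o + 1`. -/
def IsPairCoding {S E : Type} (φ : S → E × E) (o : ℤ) (x : ℤ → S) (z : ℤ → E) : Prop :=
  ∀ n, z (2 * n + o) = (φ (x n)).1 ∧ z (2 * n + o + 1) = (φ (x n)).2

theorem IsPairCoding.readWord {S E : Type} {φ : S → E × E} {o : ℤ} {x : ℤ → S} {z : ℤ → E}
    (h : IsPairCoding φ o x z) (a : ℤ) (l : ℕ) :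
    readWord z (2 * a + o) (2 * l) = pairs φ (readWord x a l) := by
  induction l generalizing a with
  | zero => rfl
  | succ l ih =>
    have h2 : 2 * a + o + 1 + 1 = 2 * (a + 1) + o := by ring
    change z _ :: z _ :: _root_.readWord z _ (2 * l) = _
    rw [h2, ih, (h a).1, (h a).2]
    rfl

/-- The sequences in `K` are exactly the pair codings of the sequences in `Λ`. -/
def IsPairCodedBy {S E : Type} (φ : S → E × E) (o : ℤ) (Λ : Set (ℤ → S)) (K : Set (ℤ → E)) :
    Prop :=
  (∀ x ∈ Λ, ∃ z ∈ K, IsPairCoding φ o x z) ∧ ∀ z ∈ K, ∃ x ∈ Λ, IsPairCoding φ o x z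

section PairCoded

variable {S E : Type} {φ : S → E × E} {o : ℤ} {Λ : Set (ℤ → S)} {K : Set (ℤ → E)}

theorem IsPairCoding.agreeOff {x x' : ℤ → S} {z z' : ℤ → E} (hφ : Function.Injective φ)
    (h : IsPairCoding φ o x z) (h' : IsPairCoding φ o x' z') (a : ℤ) (l : ℕ) :
    AgreeOff z' z (2 * a + o) (2 * l) ↔ AgreeOff x' x a l := by
  constructor
  · intro hag m hm
    refine hφ (Prod.ext ?_ ?_)
    · rw [← (h m).1, ← (h' m).1]
      exact hag _ (by push_cast; omega)
    · rw [← (h m).2, ← (h' m).2]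
      exact hag _ (by push_cast; omega)
  · intro hag m hm
    push_cast at hm
    obtain ⟨n, hn | hn⟩ : ∃ n, m = 2 * n + o ∨ m = 2 * n + o + 1 := ⟨(m - o) / 2, by omega⟩
    · rw [hn, (h n).1, (h' n).1, hag n (by omega)]
    · rw [hn, (h n).2, (h' n).2, hag n (by omega)]

theorem IsPairCodedBy.fillings (hK : IsPairCodedBy φ o Λ K) (hφ : Function.Injective φ)
    {x : ℤ → S} {z : ℤ → E} (h : IsPairCoding φ o x z) (a : ℤ) (l : ℕ) :
    fillings K z (2 * a + o) (2 * l) = pairs φ '' fillings Λ x a l := by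
  ext w
  constructor
  · rintro ⟨z', hz', hag, rfl⟩
    obtain ⟨x', hx', h'⟩ := hK.2 z' hz'
    exact ⟨_, ⟨x', hx', (h.agreeOff hφ h' a l).1 hag, rfl⟩, (h'.readWord a l).symm⟩
  · rintro ⟨-, ⟨x', hx', hag, rfl⟩, rfl⟩
    obtain ⟨z', hz', h'⟩ := hK.1 x' hx'
    exact ⟨z', hz', (h.agreeOff hφ h' a l).2 hag, h'.readWord a l⟩

theorem IsPairCodedBy.enumerates (hK : IsPairCodedBy φ o Λ K) (hφ : Function.Injective φ)
    {a : ℤ} {l : ℕ} {I : Type} {e : I → Set (List S)}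
    (he : Enumerates e (centralClasses Λ a l)) :
    Enumerates (fun i => pairs φ '' e i) (centralClasses K (2 * a + o) (2 * l)) := by
  refine ⟨(pairs_injective hφ).image_injective.comp he.1, ?_⟩
  ext W
  constructor
  · rintro ⟨i, rfl⟩
    obtain ⟨x, hx, hxi⟩ := he.mem i
    obtain ⟨z, hz, h⟩ := hK.1 x hx
    exact ⟨z, hz, by rw [hK.fillings hφ h, ← hxi]⟩
  · rintro ⟨z, hz, rfl⟩
    obtain ⟨x, hx, h⟩ := hK.2 z hz
    obtain ⟨i, hi⟩ := he.exists ⟨x, hx, rfl⟩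
    exact ⟨i, by rw [hK.fillings hφ h, ← hi]⟩

end PairCoded

theorem exists_enumerates_extending {E : Type} (𝒱 : ℕ → Set (Set (List E)))
    (hfin : ∀ n, (𝒱 n).Finite) (m : ℕ → ℕ) (w : ∀ l, Fin (m l) → Set (List E))
    (hw : ∀ l, Enumerates (w l) (𝒱 (2 * l))) :
    ∃ (c : ℕ → ℕ) (u : ∀ n, Fin (c n) → Set (List E)) (hc : ∀ l, c (2 * l) = m l),
      (∀ n, Enumerates (u n) (𝒱 n)) ∧ ∀ l i, u (2 * l) (Fin.cast (hc l).symm i) = w l i := by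
  have key : ∀ n, ∃ (c : ℕ) (u : Fin c → Set (List E)), Enumerates u (𝒱 n) ∧
      ∀ l, n = 2 * l → ∃ hc : c = m l, ∀ i, u (Fin.cast hc.symm i) = w l i := by
    intro n
    by_cases hn : ∃ l, n = 2 * l
    · obtain ⟨l, rfl⟩ := hn
      refine ⟨m l, w l, hw l, fun l' hl' => ?_⟩
      obtain rfl : l = l' := by omega
      exact ⟨rfl, fun i => rfl⟩
    · have := (hfin n).to_subtype
      refine ⟨Nat.card (𝒱 n), fun i => ((Finite.equivFin (𝒱 n)).symm i).1, ⟨?_, ?_⟩,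
        fun l hl => absurd ⟨l, hl⟩ hn⟩
      · exact Subtype.val_injective.comp (Equiv.injective _)
      · ext W
        constructor
        · rintro ⟨i, rfl⟩
          exact Subtype.coe_prop _
        · intro hW
          exact ⟨Finite.equivFin _ ⟨W, hW⟩, congrArg Subtype.val (Equiv.symm_apply_apply _ _)⟩
  choose c u hu h using key
  choose hc hcu using fun l => h (2 * l) l rfl
  exact ⟨c, u, hc, hu, hcu⟩

theorem psse1_of_isPairCodedBy {S S' E : Type} [Finite E] {Λ : Set (ℤ → S)}
    {Λ' : Set (ℤ → S')} {K : Set (ℤ → E)} {φ : S → E × E} {ψ : S' → E × E}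
    (hK2 : ShiftInv 2 K) (hφ : Function.Injective φ) (hψ : Function.Injective ψ)
    (hΛ : IsPairCodedBy φ 0 Λ K) (hΛ' : IsPairCodedBy ψ 1 Λ' K)
    {M : SMBData S S} {N : SMBData S' S'} {e : ∀ l, Fin (M.m l) → Set (List S)}
    {e' : ∀ l, Fin (N.m l) → Set (List S')} (hM : IsClassPresentation Λ M e)
    (hN : IsClassPresentation Λ' N e') : PSSE1 M N := by
  have hCe : ∀ l : ℕ, centralClasses K (-((2 * l : ℕ) : ℤ)) (2 * l)
      = centralClasses K (2 * 0 + 0) (2 * l) := by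
    intro l
    rw [← centralClasses_add (hK2.mul (-l)) (2 * 0 + 0)]
    congr 1
    push_cast
    ring
  have hDe : ∀ l : ℕ, centralClasses K (1 - ((2 * l : ℕ) : ℤ)) (2 * l)
      = centralClasses K (2 * 0 + 1) (2 * l) := by
    intro l
    rw [← centralClasses_add (hK2.mul (-l)) (2 * 0 + 1)]
    congr 1
    push_cast
    ring
  obtain ⟨c, u, hc, hu, hue⟩ := exists_enumerates_extending
    (fun n => centralClasses K (-(n : ℤ)) n) (fun n => finite_centralClasses _ _ _) M.m
    (fun l i => pairs φ '' e l i)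
    (fun l => by rw [hCe]; exact hΛ.enumerates hφ (hM.enum l))
  obtain ⟨d, v, hd, hv, hve⟩ := exists_enumerates_extending
    (fun n => centralClasses K (1 - (n : ℤ)) n) (fun n => finite_centralClasses _ _ _) N.m
    (fun l i => pairs ψ '' e' l i)
    (fun l => by rw [hDe]; exact hΛ'.enumerates hψ (hN.enum l))
  have hP : ∀ n : ℕ, QuotClosed rq (centralClasses K (-(n : ℤ)) n)
      (centralClasses K (1 - ((n + 1 : ℕ) : ℤ)) (n + 1)) := by
    intro n
    have h := quotClosed_rq K (1 - ((n + 1 : ℕ) : ℤ)) n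
    rwa [show (1 : ℤ) - ((n + 1 : ℕ) : ℤ) = -(n : ℤ) by push_cast; ring] at h ⊢
  have hQ : ∀ n : ℕ, QuotClosed rq (centralClasses K (1 - (n : ℤ)) n)
      (centralClasses K (-((n + 1 : ℕ) : ℤ)) (n + 1)) := by
    intro n
    have h := quotClosed_rq K (-((n + 1 : ℕ) : ℤ)) n
    rw [← centralClasses_add hK2 _ n] at h
    rwa [show -((n + 1 : ℕ) : ℤ) + 2 = 1 - (n : ℤ) by push_cast; ring] at h
  have hX : ∀ n : ℕ, QuotClosed lq (centralClasses K (-(n : ℤ)) n)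
      (centralClasses K (-((n + 1 : ℕ) : ℤ)) (n + 1)) := by
    intro n
    have h := quotClosed_lq K (-((n + 1 : ℕ) : ℤ)) n
    rwa [show -((n + 1 : ℕ) : ℤ) + 1 = -(n : ℤ) by push_cast; ring] at h
  have hY : ∀ n : ℕ, QuotClosed lq (centralClasses K (1 - (n : ℤ)) n)
      (centralClasses K (1 - ((n + 1 : ℕ) : ℤ)) (n + 1)) := by
    intro n
    have h := quotClosed_lq K (1 - ((n + 1 : ℕ) : ℤ)) n
    rwa [show 1 - ((n + 1 : ℕ) : ℤ) + 1 = 1 - (n : ℤ) by push_cast; ring] at h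
  have hune : ∀ n i, (u n i).Nonempty := fun n i =>
    nonempty_of_mem_centralClasses ((hu n).mem i)
  have hvne : ∀ n i, (v n i).Nonempty := fun n i =>
    nonempty_of_mem_centralClasses ((hv n).mem i)
  choose P P_spec using fun n => exists_isQuotMat rq (u n) (v (n + 1))
  choose Q Q_spec using fun n => exists_isQuotMat rq (v n) (u (n + 1))
  choose X X_spec using fun n => exists_isQuotMat lq (u n) (u (n + 1))
  choose Y Y_spec using fun n => exists_isQuotMat lq (v n) (v (n + 1))
  refine ⟨E, E, ⟨{
    φ := φ, ψ := ψ, φ_inj := hφ, ψ_inj := hψ, c := c, d := d, hc := hc, hd := hd, P := P, Q := Q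
    Xe := fun l => X (2 * l), Xo := fun l => Y (2 * l + 1), Ye := fun l => Y (2 * l)
    Yo := fun l => X (2 * l + 1)
    hMp := fun l i j => ?_
    hNp := fun l i j => ?_
    hMm := fun l i j => ?_
    hNm := fun l i j => ?_
    hYP := fun l => (X_spec _).symMul_swap (P_spec _) (P_spec _) (Y_spec _) (hune _) (hu _)
      (hv _) (hv _) (hP _) (hY _) nonempty_of_lq nonempty_of_rq lq_rq
    hXQ := fun l => (Y_spec _).symMul_swap (Q_spec _) (Q_spec _) (X_spec _) (hvne _) (hv _)
      (hu _) (hu _) (hQ _) (hX _) nonempty_of_lq nonempty_of_rq lq_rq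
    hXP := fun l => (X_spec _).symMul_swap (P_spec _) (P_spec _) (Y_spec _) (hune _) (hu _)
      (hv _) (hv _) (hP _) (hY _) nonempty_of_lq nonempty_of_rq lq_rq
    hYQ := fun l => (Y_spec _).symMul_swap (Q_spec _) (Q_spec _) (X_spec _) (hvne _) (hv _)
      (hu _) (hu _) (hQ _) (hX _) nonempty_of_lq nonempty_of_rq lq_rq }⟩⟩
  · rw [Multiset.Nodup.ext (((hM.plus l).1 i j).map hφ)
      ((P_spec _).nodup_symMul (Q_spec _) (hv _) _ _)]
    intro p
    rw [(P_spec _).mem_symMul (Q_spec _) (hune _) (hv _) (hu _) (hQ _) nonempty_of_rq, hue]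
    erw [hue (l + 1) j]
    rw [eq_rq_rq_pairs_iff hφ (hM.nonempty l i)]
    simp only [Multiset.mem_map, (hM.plus l).2]
  · rw [Multiset.Nodup.ext (((hN.plus l).1 i j).map hψ)
      ((Q_spec _).nodup_symMul (P_spec _) (hu _) _ _)]
    intro p
    rw [(Q_spec _).mem_symMul (P_spec _) (hvne _) (hu _) (hv _) (hP _) nonempty_of_rq, hve]
    erw [hve (l + 1) j]
    rw [eq_rq_rq_pairs_iff hψ (hN.nonempty l i)]
    simp only [Multiset.mem_map, (hN.plus l).2]
  · rw [Multiset.Nodup.ext (((hM.minus l).1 i j).map (Prod.swap_injective.comp hφ))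
      ((X_spec _).nodup_symMul (X_spec _) (hu _) _ _)]
    intro p
    rw [(X_spec _).mem_symMul (X_spec _) (hune _) (hu _) (hu _) (hX _) nonempty_of_lq, hue]
    erw [hue (l + 1) j]
    refine Iff.trans ?_ (eq_lq_lq_pairs_iff hφ (hM.nonempty l i) p.swap).symm
    simp only [Multiset.mem_map, (hM.minus l).2, Function.comp_apply, Prod.swap_eq_iff_eq_swap]
  · rw [Multiset.Nodup.ext (((hN.minus l).1 i j).map (Prod.swap_injective.comp hψ))
      ((Y_spec _).nodup_symMul (Y_spec _) (hv _) _ _)]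
    intro p
    rw [(Y_spec _).mem_symMul (Y_spec _) (hvne _) (hv _) (hv _) (hY _) nonempty_of_lq, hve]
    erw [hve (l + 1) j]
    refine Iff.trans ?_ (eq_lq_lq_pairs_iff hψ (hN.nonempty l i) p.swap).symm
    simp only [Multiset.mem_map, (hN.minus l).2, Function.comp_apply, Prod.swap_eq_iff_eq_swap]

/-! ### Strong shift equivalence of factor codings of a bijection -/

/-- Exchanging the two bisystems. -/
def PSSE1Data.symm {C D SM SN : Type} {M : SMBData SM SM} {N : SMBData SN SN}
    (h : PSSE1Data C D M N) : PSSE1Data D C N M where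
  φ := h.ψ
  ψ := h.φ
  φ_inj := h.ψ_inj
  ψ_inj := h.φ_inj
  c := h.d
  d := h.c
  hc := h.hd
  hd := h.hc
  P := h.Q
  Q := h.P
  Xe := h.Ye
  Xo := h.Yo
  Ye := h.Xe
  Yo := h.Xo
  hMp := h.hNp
  hNp := h.hMp
  hMm := h.hNm
  hNm := h.hMm
  hYP := h.hXQ
  hXQ := h.hYP
  hXP := h.hYQ
  hYQ := h.hXP

theorem PSSE1.symm {SM SN : Type} {M : SMBData SM SM} {N : SMBData SN SN} (h : PSSE1 M N) :
    PSSE1 N M := by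
  obtain ⟨C, D, ⟨h⟩⟩ := h
  exact ⟨D, C, ⟨h.symm⟩⟩

/-- All class presentations of the two sets of sequences are properly strong shift equivalent. -/
def PresentationsSSE {S S' : Type} (Λ : Set (ℤ → S)) (Λ' : Set (ℤ → S')) : Prop :=
  ∀ (M : SMBData S S) (N : SMBData S' S') (e : ∀ l, Fin (M.m l) → Set (List S))
    (e' : ∀ l, Fin (N.m l) → Set (List S')), IsClassPresentation Λ M e →
    IsClassPresentation Λ' N e' → ∀ (hM : IsSMB M) (hMf : M.FPCC) (hN : IsSMB N) (hNf : N.FPCC),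
    ProperlySSE ⟨S, M, hM, hMf⟩ ⟨S', N, hN, hNf⟩

theorem PresentationsSSE.symm {S S' : Type} {Λ : Set (ℤ → S)} {Λ' : Set (ℤ → S')}
    (h : PresentationsSSE Λ Λ') : PresentationsSSE Λ' Λ := by
  intro M N e e' he he' hM hMf hN hNf
  have : Std.Symm fun u v : SMBBundle => PSSE1 u.data v.data := ⟨fun _ _ h => h.symm⟩
  exact Relation.ReflTransGen.stdSymm.symm _ _ (h N M e' e he' he hN hNf hM hMf)

theorem PresentationsSSE.trans {S S' S'' : Type} [Finite S'] {Λ : Set (ℤ → S)}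
    {Λ' : Set (ℤ → S')} {Λ'' : Set (ℤ → S'')} (h : PresentationsSSE Λ Λ')
    (h' : PresentationsSSE Λ' Λ'') (hΛ : ShiftInv 1 Λ') (hne : Λ'.Nonempty) :
    PresentationsSSE Λ Λ'' := by
  intro M N e e' he he' hM hMf hN hNf
  obtain ⟨L, e₁, he₁⟩ := exists_isClassPresentation Λ'
  have hL := he₁.isSMB hΛ hne
  have hLf := he₁.fpcc hΛ hne
  exact (h M L e e₁ he he₁ hM hMf hL hLf).trans (h' L N e₁ e' he₁ he' hL hLf hN hNf)

/-- The itineraries of the points of `X` under the bijection `T`, read through `f`. -/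
def itineraries {X S : Type} (T : Equiv.Perm X) (f : X → S) : Set (ℤ → S) :=
  Set.range fun x n => f ((T ^ n) x)

section Itineraries

variable {X : Type} (T : Equiv.Perm X)

theorem zpow_add_apply' (m n : ℤ) (x : X) : (T ^ (m + n)) x = (T ^ m) ((T ^ n) x) := by
  rw [zpow_add, Equiv.Perm.mul_apply]

theorem shiftInv_itineraries {S : Type} (f : X → S) : ShiftInv 1 (itineraries T f) := by
  intro z
  constructor
  · rintro ⟨x, hx⟩
    refine ⟨(T ^ (-1 : ℤ)) x, funext fun n => ?_⟩
    have h := congrFun hx (n + -1)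
    simp only [shiftZ, neg_add_cancel_right] at h
    rw [← h, zpow_add_apply']
  · rintro ⟨x, rfl⟩
    exact ⟨(T ^ (1 : ℤ)) x, funext fun n => by simp only [shiftZ, zpow_add_apply']⟩

theorem itineraries_comp {S : Type} (f : X → S) :
    itineraries T (fun x => f (T x)) = itineraries T f := by
  have key : ∀ (n : ℤ) x, T ((T ^ n) x) = (T ^ n) (T x) := fun n x => by
    rw [← Equiv.Perm.mul_apply, ← Equiv.Perm.mul_apply, mul_self_zpow, mul_zpow_self]
  ext z
  constructor
  · rintro ⟨x, rfl⟩
    exact ⟨T x, funext fun n => by simp only [key]⟩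
  · rintro ⟨x, rfl⟩
    exact ⟨T.symm x, funext fun n => by simp only [key, Equiv.apply_symm_apply]⟩

theorem itineraries_nonempty [Nonempty X] {S : Type} (f : X → S) : (itineraries T f).Nonempty :=
  Set.range_nonempty _

theorem presentationsSSE_of_interleaving {S S' E : Type} [Finite E] {f : X → S} {g : X → S'}
    (γ δ : X → E) {φ : S → E × E} {ψ : S' → E × E} (hφ : Function.Injective φ)
    (hψ : Function.Injective ψ) (hf : ∀ x, φ (f x) = (γ x, δ x))
    (hg : ∀ x, ψ (g x) = (δ x, γ (T x))) :
    PresentationsSSE (itineraries T f) (itineraries T g) := by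
  intro M N e e' he he' hM hMf hN hNf
  let z : X → ℤ → E := fun x m => if 2 ∣ m then γ ((T ^ (m / 2)) x) else δ ((T ^ (m / 2)) x)
  have z_even : ∀ x n, z x (2 * n) = γ ((T ^ n) x) := fun x n => by simp [z]
  have z_odd : ∀ x n, z x (2 * n + 1) = δ ((T ^ n) x) := fun x n => by
    have h1 : ¬ (2 : ℤ) ∣ 2 * n + 1 := by omega
    have h2 : (2 * n + 1) / 2 = n := by omega
    simp only [z, if_neg h1, h2]
  have z_shift : ∀ x, shiftZ 2 (z x) = z (T x) := fun x => by
    funext m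
    have h1 : (2 ∣ m + 2) = (2 ∣ m) := propext (by omega)
    have h2 : (m + 2) / 2 = m / 2 + 1 := by omega
    simp only [shiftZ, z, h1, h2, zpow_add_apply', zpow_one]
  have c0 : ∀ x, IsPairCoding φ 0 (fun n => f ((T ^ n) x)) (z x) := fun x n => by
    rw [add_zero, hf, z_even, z_odd]
    exact ⟨rfl, rfl⟩
  have c1 : ∀ x, IsPairCoding ψ 1 (fun n => g ((T ^ n) x)) (z x) := fun x n => by
    rw [hg, z_odd, show 2 * n + 1 + 1 = 2 * (1 + n) by ring, z_even, zpow_add_apply', zpow_one]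
    exact ⟨rfl, rfl⟩
  refine Relation.ReflTransGen.single (psse1_of_isPairCodedBy (K := Set.range z) ?_ hφ hψ
    ⟨?_, ?_⟩ ⟨?_, ?_⟩ he he')
  · intro w
    constructor
    · rintro ⟨x, hx⟩
      refine ⟨T.symm x, ?_⟩
      have h := z_shift (T.symm x)
      rw [Equiv.apply_symm_apply, hx] at h
      funext m
      simpa [shiftZ] using congrFun h (m - 2)
    · rintro ⟨x, rfl⟩
      exact ⟨T x, (z_shift x).symm⟩
  · rintro - ⟨x, rfl⟩
    exact ⟨z x, ⟨x, rfl⟩, c0 x⟩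
  · rintro - ⟨x, rfl⟩
    exact ⟨_, ⟨x, rfl⟩, c0 x⟩
  · rintro - ⟨x, rfl⟩
    exact ⟨z x, ⟨x, rfl⟩, c1 x⟩
  · rintro - ⟨x, rfl⟩
    exact ⟨_, ⟨x, rfl⟩, c1 x⟩

theorem presentationsSSE_of_eq_iff {S S' : Type} [Finite S] [Finite S'] {f : X → S} {g : X → S'}
    (h : ∀ x x', f x = f x' ↔ g x = g x') :
    PresentationsSSE (itineraries T f) (itineraries T g) := by
  classical
  rw [← itineraries_comp T g]
  refine presentationsSSE_of_interleaving T (E := Option (S ⊕ S'))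
    (fun x => some (Sum.inr (g x))) (fun _ => none)
    (φ := fun a => (if ha : ∃ x, f x = a then some (Sum.inr (g ha.choose)) else
      some (Sum.inl a), none)) (ψ := fun b => (none, some (Sum.inr b))) ?_ ?_ ?_ ?_
  · intro a a' haa
    simp only [Prod.mk.injEq, and_true] at haa
    split_ifs at haa with h1 h2 h2
    · simp only [Option.some.injEq, Sum.inr.injEq] at haa
      rw [← h1.choose_spec, ← h2.choose_spec, h, haa]
    · simp at haa
    · simp at haa
    · simpa using haa
  · intro b b' hbb
    simpa using hbb
  · intro x
    have hx : ∃ y, f y = f x := ⟨x, rfl⟩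
    simp only [dif_pos hx]
    rw [(h _ _).1 hx.choose_spec]
  · intro x
    rfl

theorem presentationsSSE_refl {S : Type} [Finite S] (f : X → S) :
    PresentationsSSE (itineraries T f) (itineraries T f) :=
  presentationsSSE_of_eq_iff T fun _ _ => Iff.rfl

section Shifts

variable {ι S : Type} [Finite ι] [Finite S] (f : ι → X → S)

theorem presentationsSSE_update_add_one [DecidableEq ι] (s : ι → ℤ) (i₀ : ι) :
    PresentationsSSE (itineraries T fun x i => f i ((T ^ s i) x))
      (itineraries T fun x i => f i ((T ^ Function.update s i₀ (s i₀ + 1) i) x)) := by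
  refine presentationsSSE_of_interleaving T (E := ι → Option S)
    (fun x i => if i = i₀ then some (f i ((T ^ s i) x)) else none)
    (fun x i => if i = i₀ then none else some (f i ((T ^ s i) x)))
    (φ := fun a => (fun i => if i = i₀ then some (a i) else none,
      fun i => if i = i₀ then none else some (a i)))
    (ψ := fun a => (fun i => if i = i₀ then none else some (a i),
      fun i => if i = i₀ then some (a i) else none)) ?_ ?_ (fun x => rfl) ?_
  · intro a a' h
    simp only [Prod.mk.injEq, funext_iff] at h
    funext i
    have h1 := h.1 i
    have h2 := h.2 i
    by_cases hi : i = i₀ <;> simp_all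
  · intro a a' h
    simp only [Prod.mk.injEq, funext_iff] at h
    funext i
    have h1 := h.1 i
    have h2 := h.2 i
    by_cases hi : i = i₀ <;> simp_all
  · intro x
    refine Prod.ext (funext fun i => ?_) (funext fun i => ?_)
    · by_cases hi : i = i₀ <;> simp [hi]
    · by_cases hi : i = i₀
      · subst hi
        simp [zpow_add_apply']
      · simp [hi]

theorem presentationsSSE_shifts [Nonempty X] (s s' : ι → ℤ) :
    PresentationsSSE (itineraries T fun x i => f i ((T ^ s i) x))
      (itineraries T fun x i => f i ((T ^ s' i) x)) := by
  classical
  have hupd : ∀ (s : ι → ℤ) (i₀ : ι) (k : ℤ),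
      PresentationsSSE (itineraries T fun x i => f i ((T ^ s i) x))
        (itineraries T fun x i => f i ((T ^ Function.update s i₀ (s i₀ + k) i) x)) := by
    intro s i₀ k
    induction k using Int.induction_on with
    | zero =>
      rw [add_zero, Function.update_eq_self]
      exact presentationsSSE_refl T _
    | succ k ih =>
      have h := presentationsSSE_update_add_one T f (Function.update s i₀ (s i₀ + k)) i₀
      rw [Function.update_self, Function.update_idem, add_assoc] at h
      exact ih.trans h (shiftInv_itineraries T _) (itineraries_nonempty T _)
    | pred k ih =>
      have h := presentationsSSE_update_add_one T f (Function.update s i₀ (s i₀ + (-k - 1))) i₀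
      rw [Function.update_self, Function.update_idem, add_assoc, sub_add_cancel] at h
      exact ih.trans h.symm (shiftInv_itineraries T _) (itineraries_nonempty T _)
  have := Fintype.ofFinite ι
  have key : ∀ J : Finset ι, PresentationsSSE (itineraries T fun x i => f i ((T ^ s i) x))
      (itineraries T fun x i => f i ((T ^ (if i ∈ J then s' i else s i)) x)) := by
    intro J
    induction J using Finset.induction_on with
    | empty => simpa using presentationsSSE_refl T _
    | insert i₀ J hi ih =>
      refine ih.trans ?_ (shiftInv_itineraries T _) (itineraries_nonempty T _)
      have h := hupd (fun i => if i ∈ J then s' i else s i) i₀ (s' i₀ - s i₀)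
      have hs : Function.update (fun i => if i ∈ J then s' i else s i) i₀
          ((if i₀ ∈ J then s' i₀ else s i₀) + (s' i₀ - s i₀))
          = fun i => if i ∈ insert i₀ J then s' i else s i := by
        funext i
        by_cases h : i = i₀
        · subst h
          simp [hi]
        · simp [h]
      rw [hs] at h
      exact h
  simpa using key Finset.univ

end Shifts

theorem presentationsSSE_prod [Nonempty X] {A B ι : Type} [Finite A] [Finite B] [Finite ι]
    [Nonempty ι] {α : X → A} {β : X → B} (s : ι → ℤ)
    (h : ∀ x x', (∀ i, α ((T ^ s i) x) = α ((T ^ s i) x')) → β x = β x') :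
    PresentationsSSE (itineraries T α) (itineraries T fun x => (α x, β x)) := by
  let F : Option ι → X → A ⊕ B := fun o => o.elim (fun x => Sum.inr (β x))
    fun _ x => Sum.inl (α x)
  let t : Option ι → ℤ := fun o => o.elim 0 s
  have h1 : PresentationsSSE (itineraries T α) (itineraries T fun x (_ : ι) => α ((T ^ (0 : ℤ)) x)) :=
    presentationsSSE_of_eq_iff T fun x x' => by
      simp [funext_iff]
  have h2 := presentationsSSE_shifts T (fun _ : ι => α) (fun _ => 0) s
  have h3 : PresentationsSSE (itineraries T fun x (i : ι) => α ((T ^ s i) x))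
      (itineraries T fun x o => F o ((T ^ t o) x)) :=
    presentationsSSE_of_eq_iff T fun x x' => by
      simp only [funext_iff, Option.forall, F, t, Option.elim_none, Option.elim_some, zpow_zero,
        Equiv.Perm.one_apply, Sum.inl.injEq, Sum.inr.injEq]
      exact ⟨fun hx => ⟨h x x' hx, hx⟩, And.right⟩
  have h4 := presentationsSSE_shifts T F t fun _ => 0
  have h5 : PresentationsSSE (itineraries T fun x o => F o ((T ^ (0 : ℤ)) x))
      (itineraries T fun x => (α x, β x)) :=
    presentationsSSE_of_eq_iff T fun x x' => by
      simp only [funext_iff, Option.forall, F, Option.elim_none, Option.elim_some, zpow_zero,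
        Equiv.Perm.one_apply, Sum.inl.injEq, Sum.inr.injEq, forall_const, Prod.mk.injEq]
      exact and_comm
  exact (((h1.trans h2 (shiftInv_itineraries T _) (itineraries_nonempty T _)).trans h3
    (shiftInv_itineraries T _) (itineraries_nonempty T _)).trans h4
    (shiftInv_itineraries T _) (itineraries_nonempty T _)).trans h5
    (shiftInv_itineraries T _) (itineraries_nonempty T _)

theorem presentationsSSE_of_windows [Nonempty X] {A B ι : Type} [Finite A] [Finite B] [Finite ι]
    [Nonempty ι] {α : X → A} {β : X → B} (s : ι → ℤ)
    (hβ : ∀ x x', (∀ i, α ((T ^ s i) x) = α ((T ^ s i) x')) → β x = β x')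
    (hα : ∀ x x', (∀ i, β ((T ^ s i) x) = β ((T ^ s i) x')) → α x = α x') :
    PresentationsSSE (itineraries T α) (itineraries T β) := by
  have h : PresentationsSSE (itineraries T fun x => (α x, β x))
      (itineraries T fun x => (β x, α x)) :=
    presentationsSSE_of_eq_iff T fun x x' => by
      simp only [Prod.mk.injEq]
      exact and_comm
  exact ((presentationsSSE_prod T s hβ).trans h (shiftInv_itineraries T _)
    (itineraries_nonempty T _)).trans (presentationsSSE_prod T s hα).symm
    (shiftInv_itineraries T _) (itineraries_nonempty T _)

end Itineraries

/-! ### The canonical λ-graph bisystem in terms of sets of fillings -/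

section Canonical

variable {A : Type} {Λ : Set (ℤ → A)}

theorem agreeOff_splice (x μ : ℤ → A) {k l : ℤ} {n : ℕ} (hl : l = k + 1 + n) :
    AgreeOff (splice x k l μ) x (k + 1) n := by
  intro m hm
  rw [splice, if_neg (by omega)]

theorem splice_eq_of_agreeOff {x z : ℤ → A} {k l : ℤ} {n : ℕ} (hl : l = k + 1 + n)
    (h : AgreeOff z x (k + 1) n) : splice x k l z = z := by
  funext m
  rw [splice]
  split_ifs with hm
  · rfl
  · exact (h m (by omega)).symm

theorem WSet_eq_iff (x y : ℤ → A) {k l : ℤ} {n : ℕ} (hl : l = k + 1 + n) :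
    WSet Λ k l x = WSet Λ k l y ↔ fillings Λ x (k + 1) n = fillings Λ y (k + 1) n := by
  have key : ∀ (x μ : ℤ → A), μ ∈ WSet Λ k l x ↔
      readWord μ (k + 1) n ∈ fillings Λ x (k + 1) n := by
    intro x μ
    have hr : readWord (splice x k l μ) (k + 1) n = readWord μ (k + 1) n := by
      rw [readWord_eq_iff]
      intro m hm
      rw [splice, if_pos (by omega)]
    constructor
    · intro h
      exact ⟨_, h, agreeOff_splice x μ hl, hr⟩
    · rintro ⟨z, hz, hag, hw⟩
      have hs : splice x k l μ = z := by
        rw [← splice_eq_of_agreeOff hl hag]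
        funext m
        simp only [splice]
        split_ifs with hm
        · obtain ⟨i, hi⟩ := Int.eq_ofNat_of_zero_le (show 0 ≤ m - (k + 1) by omega)
          obtain rfl : m = k + 1 + i := by omega
          exact ((readWord_eq_iff _ _ _ _ _).1 hw i (by omega)).symm
        · rfl
      change splice x k l μ ∈ Λ
      rwa [hs]
  constructor
  · intro h
    ext w
    constructor <;>
    · rintro ⟨z, hz, hag, rfl⟩
      rw [← key]
      first | rw [← h] | rw [h]
      exact (key _ _).2 ⟨z, hz, hag, rfl⟩
  · intro h
    ext μ
    rw [key, key, h]

/-- The set of fillings of the points in a central class. -/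
def classFillings (Λ : Set (ℤ → A)) (l : ℕ) : Vq Λ l → Set (List A) :=
  Quotient.lift (fun x : ↥Λ => fillings Λ x.1 (-(l : ℤ) + 1) l)
    fun x y h => (WSet_eq_iff x.1 y.1 (by ring)).1 h

theorem classFillings_injective (l : ℕ) : Function.Injective (classFillings Λ l) := by
  intro p q
  induction p using Quotient.ind
  induction q using Quotient.ind
  exact fun h => Quotient.sound ((WSet_eq_iff _ _ (by ring)).2 h)

theorem enumerates_classFillings (hΛ : ShiftInv 1 Λ) (l : ℕ) :
    Enumerates (classFillings Λ l) (centralClasses Λ 0 l) := by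
  refine ⟨classFillings_injective l, ?_⟩
  rw [centralClasses_congr hΛ 0 (-(l : ℤ) + 1) l]
  ext W
  constructor
  · rintro ⟨q, rfl⟩
    induction q using Quotient.ind with
    | _ x => exact ⟨x.1, x.2, rfl⟩
  · rintro ⟨x, hx, rfl⟩
    exact ⟨Quotient.mk _ ⟨x, hx⟩, rfl⟩

theorem minusRel_iff (l : ℕ) (β : A) (c' : Vq Λ (l + 1)) (c : Vq Λ l) :
    minusRel Λ l β c' c ↔ classFillings Λ l c = lq β (classFillings Λ (l + 1) c') := by
  have hstart : -((l + 1 : ℕ) : ℤ) + 1 = -(l : ℤ) := by push_cast; ring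
  have hend : (1 : ℤ) = -((l + 1 : ℕ) : ℤ) + 1 + (l + 1 : ℕ) := by ring
  have key : ∀ (y : ↥Λ) (z : ℤ → A) (hz : z ∈ Λ),
      AgreeOff z y.1 (-((l + 1 : ℕ) : ℤ) + 1) (l + 1) → z (-(l : ℤ)) = β →
      classFillings Λ l (Quotient.mk _ ⟨z, hz⟩)
        = lq β (classFillings Λ (l + 1) (Quotient.mk _ y)) := by
    intro y z hz hag hβ
    have h := lq_fillings Λ hag
    rw [hstart, hβ] at h
    change fillings Λ z _ l = lq β (fillings Λ y.1 (-((l + 1 : ℕ) : ℤ) + 1) (l + 1))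
    rw [hstart, h]
  constructor
  · rintro ⟨y, rfl, v, h, hv, rfl⟩
    refine key y _ h (agreeOff_splice _ _ hend) ?_
    rw [splice, if_pos (by omega), hv]
  · induction c' using Quotient.ind with
    | _ y =>
    induction c using Quotient.ind with
    | _ x =>
    intro h
    have hx : readWord x.1 (-(l : ℤ) + 1) l ∈ classFillings Λ l (Quotient.mk _ x) :=
      readWord_mem_fillings x.2 _ _
    rw [h] at hx
    obtain ⟨z, hz, hag, hw⟩ := hx
    have hβ : z (-(l : ℤ)) = β := by
      rw [← hstart]
      exact (List.cons.inj hw).1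
    refine ⟨y, rfl, z, by rwa [splice_eq_of_agreeOff hend hag], hβ, ?_⟩
    apply classFillings_injective l
    rw [h, ← key y z hz hag hβ]
    congr 2
    exact Subtype.ext (splice_eq_of_agreeOff hend hag)

theorem plusRel_iff (hΛ : ShiftInv 1 Λ) (l : ℕ) (α : A) (c : Vq Λ l) (c' : Vq Λ (l + 1)) :
    plusRel Λ l α c c' ↔ classFillings Λ l c = rq α (classFillings Λ (l + 1) c') := by
  have hstart : (0 : ℤ) = -1 + 1 := rfl
  have hend : (l : ℤ) + 1 = -1 + 1 + (l + 1 : ℕ) := by push_cast; ring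
  have hy : ∀ y : ↥Λ, classFillings Λ (l + 1) (Quotient.mk _ y)
      = fillings Λ (shiftZ (-(l : ℤ)) y.1) (-1 + 1) (l + 1) := by
    intro y
    rw [fillings_shiftZ (hΛ.all _)]
    change fillings Λ y.1 _ (l + 1) = _
    congr 1
    push_cast
    ring
  have key : ∀ (y : ↥Λ) (z : ℤ → A) (_ : z ∈ Λ) (hz' : shiftZ ((l : ℤ) - 1) z ∈ Λ),
      AgreeOff z (shiftZ (-(l : ℤ)) y.1) (-1 + 1) (l + 1) → z (l : ℤ) = α →
      classFillings Λ l (Quotient.mk _ ⟨shiftZ ((l : ℤ) - 1) z, hz'⟩)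
        = rq α (classFillings Λ (l + 1) (Quotient.mk _ y)) := by
    intro y z hz hz' hag hα
    have h := rq_fillings Λ hag
    rw [show (-1 : ℤ) + 1 + l = l by ring, hα] at h
    rw [hy, h]
    change fillings Λ (shiftZ ((l : ℤ) - 1) z) _ l = _
    rw [fillings_shiftZ (hΛ.all _)]
    congr 1
    ring
  constructor
  · rintro ⟨y, rfl, v, h, hv, h2, rfl⟩
    refine key y _ h h2 (agreeOff_splice _ _ hend) ?_
    rw [splice, if_pos (by omega), hv]
  · induction c' using Quotient.ind with
    | _ y =>
    induction c using Quotient.ind with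
    | _ x =>
    intro h
    have hx : readWord x.1 (-(l : ℤ) + 1) l ∈ classFillings Λ l (Quotient.mk _ x) :=
      readWord_mem_fillings x.2 _ _
    rw [h, hy] at hx
    obtain ⟨z, hz, hag, hw⟩ := hx
    have hα : z (l : ℤ) = α := by
      rw [readWord_succ'] at hw
      have h1 := (List.append_inj' hw rfl).2
      simpa using h1
    have hs := splice_eq_of_agreeOff hend hag
    have hz' : shiftZ ((l : ℤ) - 1) z ∈ Λ := (hΛ.all _ z).2 hz
    refine ⟨y, rfl, z, by rwa [hs], hα, by rwa [hs], ?_⟩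
    apply classFillings_injective l
    rw [h, ← key y z hz hz' hag hα]
    congr 2
    exact Subtype.ext (congrArg (shiftZ _) hs)

theorem Presents.exists_isClassPresentation {M : SMBData A A}
    (h : Presents M (canonicalLGBS Λ)) (hΛ : ShiftInv 1 Λ) :
    ∃ e : ∀ l, Fin (M.m l) → Set (List A), IsClassPresentation Λ M e := by
  obtain ⟨e, hm, hp⟩ : ∃ e : ∀ l, Vq Λ l ≃ Fin (M.m l),
      (∀ l i j, (M.Mm l i j).Nodup ∧
        ∀ a, a ∈ M.Mm l i j ↔ minusRel Λ l a ((e (l + 1)).symm j) ((e l).symm i)) ∧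
      ∀ l i j, (M.Mp l i j).Nodup ∧
        ∀ a, a ∈ M.Mp l i j ↔ plusRel Λ l a ((e l).symm i) ((e (l + 1)).symm j) := by
    obtain ⟨e, hm, hp⟩ := h
    refine ⟨e, fun l i j => ⟨(hm l i j).1, fun a => ((hm l i j).2 a).trans ⟨?_, ?_⟩⟩,
      fun l i j => ⟨(hp l i j).1, fun a => ((hp l i j).2 a).trans ⟨?_, ?_⟩⟩⟩
    · rintro ⟨⟨⟨c', b, c⟩, hrel⟩, h1, h2, h3⟩
      change c' = _ at h1
      change c = _ at h2
      change b = _ at h3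
      subst h1 h2 h3
      exact hrel
    · exact fun hrel => ⟨⟨(_, _, _), hrel⟩, rfl, rfl, rfl⟩
    · rintro ⟨⟨⟨c, b, c'⟩, hrel⟩, h1, h2, h3⟩
      change c = _ at h1
      change c' = _ at h2
      change b = _ at h3
      subst h1 h2 h3
      exact hrel
    · exact fun hrel => ⟨⟨(_, _, _), hrel⟩, rfl, rfl, rfl⟩
  refine ⟨fun l i => classFillings Λ l ((e l).symm i), fun l => ⟨?_, ?_⟩, fun l => ⟨fun i j =>
    (hm l i j).1, fun i j a => ((hm l i j).2 a).trans (minusRel_iff _ _ _ _)⟩, fun l =>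
    ⟨fun i j => (hp l i j).1, fun i j a => ((hp l i j).2 a).trans (plusRel_iff hΛ _ _ _ _)⟩⟩
  · exact (classFillings_injective l).comp (e l).symm.injective
  · rw [← (enumerates_classFillings hΛ l).2]
    exact (e l).symm.surjective.range_comp (classFillings Λ l)

end Canonical

theorem IsSubshift.shiftInv {A : Type} [TopologicalSpace A] {Λ : Set (ℤ → A)}
    (h : IsSubshift Λ) : ShiftInv 1 Λ := by
  intro z
  constructor
  · intro hz
    rw [← h.2] at hz
    obtain ⟨w, hw, hwz⟩ := hz
    have : w = z := funext fun n => by simpa [shiftMap, shiftZ] using congrFun hwz (n - 1)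
    rwa [← this]
  · intro hz
    rw [← h.2]
    exact ⟨z, hz, rfl⟩

/-! ### From a conjugacy to a strong shift equivalence -/

theorem exists_window_of_continuous {A B : Type} [Finite A] [TopologicalSpace A]
    [DiscreteTopology A] [TopologicalSpace B] [DiscreteTopology B] {Λ : Set (ℤ → A)}
    (hΛ : IsClosed Λ) {F : ↥Λ → B} (hF : Continuous F) :
    ∃ N : ℕ, ∀ x x' : ↥Λ, (∀ i : ℤ, -N ≤ i → i ≤ N → x.1 i = x'.1 i) → F x = F x' := by
  by_contra! h
  have : CompactSpace ↥Λ := isCompact_iff_compactSpace.1 hΛ.isCompact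
  let Z : ℕ → Set (↥Λ × ↥Λ) := fun N =>
    {p | (∀ i : ℤ, -N ≤ i → i ≤ N → p.1.1 i = p.2.1 i) ∧ F p.1 ≠ F p.2}
  have hZ : ∀ N, IsClosed (Z N) := by
    intro N
    refine IsClosed.inter ?_ ?_
    · change IsClosed {p : ↥Λ × ↥Λ | ∀ i : ℤ, -N ≤ i → i ≤ N → p.1.1 i = p.2.1 i}
      simp only [Set.ofPred_forall]
      exact isClosed_iInter fun i => isClosed_iInter fun _ => isClosed_iInter fun _ =>
        isClosed_eq
          ((continuous_apply i).comp (continuous_subtype_val.comp continuous_fst))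
          ((continuous_apply i).comp (continuous_subtype_val.comp continuous_snd))
    · exact (isClosed_discrete {q : B × B | q.1 ≠ q.2}).preimage
        ((hF.comp continuous_fst).prodMk (hF.comp continuous_snd))
  obtain ⟨p, hp⟩ := IsCompact.nonempty_iInter_of_sequence_nonempty_isCompact_isClosed Z
    (fun N p hp => ⟨fun i h1 h2 => hp.1 i (by push_cast; omega) (by push_cast; omega), hp.2⟩)
    (fun N => by
      obtain ⟨x, x', h1, h2⟩ := h N
      exact ⟨(x, x'), h1, h2⟩)
    (hZ 0).isCompact hZ
  rw [Set.mem_iInter] at hp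
  refine (hp 0).2 (congrArg F (Subtype.ext (funext fun i => ?_)))
  exact (hp i.natAbs).1 i (by omega) (by omega)

theorem TopConj.presentationsSSE {A B : Type} [Finite A] [Finite B] [TopologicalSpace A]
    [DiscreteTopology A] [TopologicalSpace B] [DiscreteTopology B] {Λ₁ : Set (ℤ → A)}
    {Λ₂ : Set (ℤ → B)} (h1 : IsSubshift Λ₁) (h2 : IsSubshift Λ₂) (hne : Λ₁.Nonempty)
    (h : TopConj Λ₁ Λ₂) : PresentationsSSE Λ₁ Λ₂ := by
  obtain ⟨h, hh⟩ := h
  have : Nonempty ↥Λ₁ := hne.to_subtype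
  let T : Equiv.Perm ↥Λ₁ :=
    { toFun := fun x => ⟨shiftZ 1 x.1, (h1.shiftInv x.1).2 x.2⟩
      invFun := fun x => ⟨shiftZ (-1) x.1, (h1.shiftInv.neg x.1).2 x.2⟩
      left_inv := fun x => Subtype.ext (by simp [shiftZ_shiftZ, shiftZ_zero])
      right_inv := fun x => Subtype.ext (by simp [shiftZ_shiftZ, shiftZ_zero]) }
  have hT : ∀ x, (h (T x)).1 = shiftZ 1 (h x).1 := fun x => hh x.1 x.2 (T x).2
  have hTn : ∀ (n : ℤ) x, ((T ^ n) x).1 = shiftZ n x.1 ∧ (h ((T ^ n) x)).1 = shiftZ n (h x).1 := by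
    intro n
    induction n using Int.induction_on with
    | zero => simp [shiftZ_zero]
    | succ n ih =>
      intro x
      rw [zpow_add_apply', zpow_one, (ih _).1, (ih _).2, hT, shiftZ_shiftZ]
      exact ⟨shiftZ_shiftZ _ _ _, rfl⟩
    | pred n ih =>
      intro x
      have hx := hT (T.symm x)
      rw [Equiv.apply_symm_apply] at hx
      rw [sub_eq_add_neg, zpow_add_apply', zpow_neg_one, (ih _).1, (ih _).2, hx, shiftZ_shiftZ]
      exact ⟨shiftZ_shiftZ _ _ _, by rw [neg_add_cancel_right]; rfl⟩
  have e1 : itineraries T (fun x => x.1 0) = Λ₁ := by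
    have : (fun (x : ↥Λ₁) (n : ℤ) => ((T ^ n) x).1 0) = Subtype.val := by
      funext x n
      simp [(hTn n x).1, shiftZ]
    rw [itineraries, this, Subtype.range_coe]
  have e2 : itineraries T (fun x => (h x).1 0) = Λ₂ := by
    have : (fun (x : ↥Λ₁) (n : ℤ) => (h ((T ^ n) x)).1 0) = Subtype.val ∘ h := by
      funext x n
      simp [(hTn n x).2, shiftZ]
    rw [itineraries, this, h.surjective.range_comp, Subtype.range_coe]
  obtain ⟨N₁, hN₁⟩ := exists_window_of_continuous (F := fun x : ↥Λ₁ => (h x).1 0) h1.1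
    ((continuous_apply 0).comp (continuous_subtype_val.comp h.continuous))
  obtain ⟨N₂, hN₂⟩ := exists_window_of_continuous (F := fun y : ↥Λ₂ => (h.symm y).1 0) h2.1
    ((continuous_apply 0).comp (continuous_subtype_val.comp h.symm.continuous))
  let N : ℕ := max N₁ N₂
  have : Nonempty (Finset.Icc (-N : ℤ) N) := ⟨⟨0, by simp⟩⟩
  have key := presentationsSSE_of_windows T (α := fun x : ↥Λ₁ => x.1 0)
    (β := fun x : ↥Λ₁ => (h x).1 0) (fun i : Finset.Icc (-N : ℤ) N => i.1)
    (fun x x' hx => hN₁ x x' fun i hi hi' => by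
      simpa [(hTn _ _).1, shiftZ] using hx ⟨i, Finset.mem_Icc.2 ⟨by omega, by omega⟩⟩)
    (fun x x' hx => by
      have := hN₂ (h x) (h x') fun i hi hi' => by
        simpa [(hTn _ _).2, shiftZ] using hx ⟨i, Finset.mem_Icc.2 ⟨by omega, by omega⟩⟩
      simpa using this)
  rwa [e1, e2] at key

/-! ### From a strong shift equivalence to a conjugacy -/

/-- The word of length `n` of `x` from position `a` on labels a path of the `Mp` part of `M`
starting at the vertex `i` of level `l`. -/
def Admissible {S : Type} (M : SMBData S S) (x : ℤ → S) :
    ℕ → ℤ → ∀ l, Fin (M.m l) → Prop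
  | 0, _, _, _ => True
  | n + 1, a, l, i => ∃ j, x a ∈ M.Mp l i j ∧ Admissible M x n (a + 1) (l + 1) j

/-- The set of sequences presented by `M`. -/
def presented {S : Type} (M : SMBData S S) : Set (ℤ → S) :=
  {x | ∀ a n, ∃ l i, Admissible M x n a l i}

theorem TopConj.refl {A : Type} [TopologicalSpace A] (Λ : Set (ℤ → A)) : TopConj Λ Λ :=
  ⟨Homeomorph.refl _, fun _ _ _ => rfl⟩

theorem TopConj.trans {A B C : Type} [TopologicalSpace A] [TopologicalSpace B]
    [TopologicalSpace C] {X : Set (ℤ → A)} {Y : Set (ℤ → B)} {Z : Set (ℤ → C)}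
    (h : TopConj X Y) (h' : TopConj Y Z) : TopConj X Z := by
  obtain ⟨f, hf⟩ := h
  obtain ⟨g, hg⟩ := h'
  refine ⟨f.trans g, fun x hx hx' => ?_⟩
  have h1 : shiftMap (f ⟨x, hx⟩).1 ∈ Y := hf x hx hx' ▸ (f ⟨shiftMap x, hx'⟩).2
  have h2 : f ⟨shiftMap x, hx'⟩ = ⟨shiftMap (f ⟨x, hx⟩).1, h1⟩ := Subtype.ext (hf x hx hx')
  rw [Homeomorph.trans_apply, h2, hg _ (f ⟨x, hx⟩).2 h1]
  rfl

/-- `y` is obtained from `x` by recoding overlapping halves of letters. -/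
def IsHalfShift {A B C D : Type} (φ : A → C × D) (ψ : B → D × C) (x : ℤ → A) (y : ℤ → B) : Prop :=
  ∀ m, ψ (y m) = ((φ (x m)).2, (φ (x (m + 1))).1)

theorem topConj_of_isHalfShift {A B C D : Type} [TopologicalSpace A] [DiscreteTopology A]
    [TopologicalSpace B] [DiscreteTopology B] {φ : A → C × D} {ψ : B → D × C}
    (hφ : Function.Injective φ) (hψ : Function.Injective ψ) {X : Set (ℤ → A)} {Y : Set (ℤ → B)}
    (hX : ∀ x ∈ X, ∃ y ∈ Y, IsHalfShift φ ψ x y) (hY : ∀ y ∈ Y, ∃ x ∈ X, IsHalfShift φ ψ x y) :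
    TopConj X Y := by
  have inv : ∀ {x y}, IsHalfShift φ ψ x y → ∀ m, φ (x m) = ((ψ (y (m - 1))).2, (ψ (y m)).1) := by
    intro x y h m
    rw [h, h, sub_add_cancel]
  choose f hf hfc using fun x : ↥X => hX x.1 x.2
  choose g hg hgc using fun y : ↥Y => hY y.1 y.2
  have funl : ∀ {x y y'}, IsHalfShift φ ψ x y → IsHalfShift φ ψ x y' → y = y' :=
    fun h h' => funext fun m => hψ ((h m).trans (h' m).symm)
  have funr : ∀ {x x' y}, IsHalfShift φ ψ x y → IsHalfShift φ ψ x' y → x = x' :=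
    fun h h' => funext fun m => hφ ((inv h m).trans (inv h' m).symm)
  have hfcont : Continuous fun x : ↥X => (⟨f x, hf x⟩ : ↥Y) := by
    refine Continuous.subtype_mk (continuous_pi fun m => continuous_def.2 fun U _ => ?_) _
    have : (fun x : ↥X => f x m) ⁻¹' U = (fun x : ↥X => (x.1 m, x.1 (m + 1))) ⁻¹'
        {p | ∃ t ∈ U, ψ t = ((φ p.1).2, (φ p.2).1)} := by
      ext x
      constructor
      · exact fun hx => ⟨_, hx, hfc x m⟩
      · rintro ⟨t, ht, h⟩
        rwa [← hψ ((hfc x m).trans h.symm)] at ht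
    rw [this]
    exact (isOpen_discrete _).preimage (((continuous_apply m).comp continuous_subtype_val).prodMk
      ((continuous_apply (m + 1)).comp continuous_subtype_val))
  have hgcont : Continuous fun y : ↥Y => (⟨g y, hg y⟩ : ↥X) := by
    refine Continuous.subtype_mk (continuous_pi fun m => continuous_def.2 fun U _ => ?_) _
    have : (fun y : ↥Y => g y m) ⁻¹' U = (fun y : ↥Y => (y.1 (m - 1), y.1 m)) ⁻¹'
        {p | ∃ t ∈ U, φ t = ((ψ p.1).2, (ψ p.2).1)} := by
      ext y
      constructor
      · exact fun hy => ⟨_, hy, inv (hgc y) m⟩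
      · rintro ⟨t, ht, h⟩
        rwa [← hφ ((inv (hgc y) m).trans h.symm)] at ht
    rw [this]
    exact (isOpen_discrete _).preimage
      (((continuous_apply (m - 1)).comp continuous_subtype_val).prodMk
        ((continuous_apply m).comp continuous_subtype_val))
  refine ⟨⟨⟨fun x => ⟨f x, hf x⟩, fun y => ⟨g y, hg y⟩, fun x => ?_, fun y => ?_⟩,
    hfcont, hgcont⟩, fun x hx hx' => ?_⟩
  · exact Subtype.ext (funr (hgc ⟨f x, hf x⟩) (hfc x))
  · exact Subtype.ext (funl (hfc ⟨g y, hg y⟩) (hgc y))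
  · exact funl (hfc ⟨shiftMap x, hx'⟩) fun m => hfc ⟨x, hx⟩ (m + 1)

section StrongShiftEquivalence

variable {C D S S' : Type} {M : SMBData S S} {N : SMBData S' S'} (h : PSSE1Data C D M N)

/-- The analogue of `Admissible` on the intermediate odd levels of the `c` side. -/
def PSSE1Data.OddAdmissible (x : ℤ → S) : ℕ → ℤ → ∀ l, Fin (h.c (2 * l + 1)) → Prop
  | 0, _, _, _ => True
  | n + 1, a, l, v => ∃ (u : Fin (h.d (2 * l + 2))) (v' : Fin (h.c (2 * l + 3))),
      (h.φ (x a)).1 ∈ h.P (2 * l + 1) v u ∧ (h.φ (x a)).2 ∈ h.Q (2 * l + 2) u v' ∧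
      OddAdmissible x n (a + 1) (l + 1) v'

theorem PSSE1Data.exists_oddAdmissible (hM : IsSMB M) (x : ℤ → S) (n : ℕ) (a : ℤ) (l : ℕ)
    (i : Fin (M.m l)) (hi : Admissible M x n a l i) :
    ∃ (s : D) (v : Fin (h.c (2 * l + 1))), s ∈ h.Xe l (Fin.cast (h.hc l).symm i) v ∧
      h.OddAdmissible x n a l v := by
  induction n generalizing a l with
  | zero =>
    obtain ⟨j, hj⟩ := hM.row_m l i
    obtain ⟨s, hs⟩ := Multiset.exists_mem_of_ne_zero hj
    have hs' := Multiset.mem_map_of_mem (Prod.swap ∘ h.φ) hs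
    rw [h.hMm, mem_symMul] at hs'
    obtain ⟨v, hv, -⟩ := hs'
    exact ⟨_, v, hv, trivial⟩
  | succ n ih =>
    obtain ⟨j, hj, hadm⟩ := hi
    obtain ⟨s, v', hs, hv'⟩ := ih _ _ j hadm
    have hj' := Multiset.mem_map_of_mem h.φ hj
    rw [h.hMp, mem_symMul] at hj'
    obtain ⟨w, hw, hw'⟩ := hj'
    have h1 : ((h.φ (x a)).2, s) ∈ symMul (h.Q (2 * l + 1)) (h.Xe (l + 1)) w v' :=
      (mem_symMul _ _ _ _ _).2 ⟨_, hw', hs⟩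
    rw [← h.hXQ, ← Prod.swap_prod_mk, Multiset.mem_map_of_injective Prod.swap_injective,
      mem_symMul] at h1
    obtain ⟨u, hu, hu'⟩ := h1
    have h2 : ((h.φ (x a)).1, s) ∈ symMul (h.P (2 * l)) (h.Xo l)
        (Fin.cast (h.hc l).symm i) u := (mem_symMul _ _ _ _ _).2 ⟨w, hw, hu⟩
    rw [← h.hXP, ← Prod.swap_prod_mk, Multiset.mem_map_of_injective Prod.swap_injective,
      mem_symMul] at h2
    obtain ⟨v, hv, hvu⟩ := h2
    exact ⟨s, v, hv, u, v', hvu, hu', hv'⟩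

theorem PSSE1Data.exists_mem_Mp (x : ℤ → S) (n : ℕ) (a : ℤ) (l : ℕ) (i : Fin (N.m (l + 1)))
    (v : Fin (h.c (2 * l + 3)))
    (hv : (h.φ (x a)).2 ∈ h.Q (2 * l + 2) (Fin.cast (h.hd (l + 1)).symm i) v)
    (hadm : h.OddAdmissible x (n + 1) (a + 1) (l + 1) v) :
    ∃ t j, h.ψ t = ((h.φ (x a)).2, (h.φ (x (a + 1))).1) ∧ t ∈ N.Mp (l + 1) i j ∧
      ∃ v' : Fin (h.c (2 * l + 5)),
        (h.φ (x (a + 1))).2 ∈ h.Q (2 * l + 4) (Fin.cast (h.hd (l + 2)).symm j) v' ∧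
        h.OddAdmissible x n (a + 1 + 1) (l + 2) v' := by
  obtain ⟨u, v', hu, hv', hadm⟩ := hadm
  have h1 : ((h.φ (x a)).2, (h.φ (x (a + 1))).1) ∈ symMul (h.Q (2 * (l + 1)))
      (h.P (2 * (l + 1) + 1)) (Fin.cast (h.hd (l + 1)).symm i)
      (Fin.cast (h.hd (l + 2)).symm (Fin.cast (h.hd (l + 2)) u)) :=
    (mem_symMul _ _ _ _ _).2 ⟨v, hv, hu⟩
  rw [← h.hNp, Multiset.mem_map] at h1
  obtain ⟨t, ht, hψ⟩ := h1
  exact ⟨t, _, hψ, ht, v', hv', hadm⟩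

theorem PSSE1Data.admissible (x : ℤ → S) (y : ℤ → S') (hxy : IsHalfShift h.φ h.ψ x y) (n : ℕ)
    (a : ℤ) (l : ℕ) (i : Fin (N.m (l + 1))) (v : Fin (h.c (2 * l + 3)))
    (hv : (h.φ (x a)).2 ∈ h.Q (2 * l + 2) (Fin.cast (h.hd (l + 1)).symm i) v)
    (hadm : h.OddAdmissible x n (a + 1) (l + 1) v) : Admissible N y n a (l + 1) i := by
  induction n generalizing a l with
  | zero => trivial
  | succ n ih =>
    obtain ⟨t, j, ht, htj, v', hv', hadm'⟩ := h.exists_mem_Mp x n a l i v hv hadm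
    obtain rfl := h.ψ_inj (ht.trans (hxy a).symm)
    exact ⟨j, htj, ih _ _ j v' hv' hadm'⟩

theorem PSSE1Data.exists_isHalfShift (hM : IsSMB M) {x : ℤ → S} (hx : x ∈ presented M) :
    ∃ y ∈ presented N, IsHalfShift h.φ h.ψ x y := by
  have key : ∀ a n, ∃ (l : ℕ) (i : Fin (N.m (l + 1))) (v : Fin (h.c (2 * l + 3))),
      (h.φ (x a)).2 ∈ h.Q (2 * l + 2) (Fin.cast (h.hd (l + 1)).symm i) v ∧
      h.OddAdmissible x n (a + 1) (l + 1) v := by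
    intro a n
    obtain ⟨l, i, hi⟩ := hx a (n + 1)
    obtain ⟨s, v, -, u, v', -, hu, hadm⟩ := h.exists_oddAdmissible hM x (n + 1) a l i hi
    exact ⟨l, Fin.cast (h.hd (l + 1)) u, v', hu, hadm⟩
  have hy : ∀ a, ∃ t, h.ψ t = ((h.φ (x a)).2, (h.φ (x (a + 1))).1) := by
    intro a
    obtain ⟨l, i, v, hv, hadm⟩ := key a 1
    obtain ⟨t, j, ht, -⟩ := h.exists_mem_Mp x 0 a l i v hv hadm
    exact ⟨t, ht⟩
  choose y hy using hy
  refine ⟨y, fun a n => ?_, hy⟩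
  obtain ⟨l, i, v, hv, hadm⟩ := key a n
  exact ⟨l + 1, i, h.admissible x y hy n a l i v hv hadm⟩

end StrongShiftEquivalence

theorem Admissible.shiftZ {S : Type} {M : SMBData S S} {x : ℤ → S} (t : ℤ) {n : ℕ} {a : ℤ} {l : ℕ}
    {i : Fin (M.m l)} (h : Admissible M x n (a + t) l i) :
    Admissible M (shiftZ t x) n a l i := by
  induction n generalizing a l with
  | zero => trivial
  | succ n ih =>
    obtain ⟨j, hj, h⟩ := h
    exact ⟨j, hj, ih (by rwa [show a + 1 + t = a + t + 1 by ring])⟩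

theorem PSSE1.topConj_presented {S S' : Type} [TopologicalSpace S] [DiscreteTopology S]
    [TopologicalSpace S'] [DiscreteTopology S'] {M : SMBData S S} {N : SMBData S' S'}
    (h : PSSE1 M N) (hM : IsSMB M) (hN : IsSMB N) :
    TopConj (presented M) (presented N) := by
  obtain ⟨C, D, ⟨h⟩⟩ := h
  refine topConj_of_isHalfShift h.φ_inj h.ψ_inj (fun x hx => h.exists_isHalfShift hM hx) ?_
  intro y hy
  obtain ⟨x, hx, hxy⟩ := h.symm.exists_isHalfShift hN hy
  refine ⟨shiftZ (-1) x, fun a n => ?_, fun m => ?_⟩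
  · obtain ⟨l, i, hi⟩ := hx (a + -1) n
    exact ⟨l, i, hi.shiftZ⟩
  · have h1 := hxy (m - 1)
    have h2 := hxy m
    rw [sub_add_cancel] at h1
    change h.φ (x (m - 1)) = (_, (h.ψ (y m)).1) at h1
    change h.φ (x m) = ((h.ψ (y m)).2, _) at h2
    simp only [shiftZ, ← sub_eq_add_neg, add_sub_cancel_right, h1, h2]

theorem ProperlySSE.topConj_presented {b b' : SMBBundle} (h : ProperlySSE b b') :
    @TopConj _ _ ⊥ ⊥ (presented b.data) (presented b'.data) := by
  let _ : ∀ b : SMBBundle, TopologicalSpace b.carrier := fun _ => ⊥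
  have : ∀ b : SMBBundle, DiscreteTopology b.carrier := fun _ => ⟨rfl⟩
  change TopConj (presented b.data) (presented b'.data)
  induction h with
  | refl => exact TopConj.refl _
  | @tail b₁ b₂ _ hstep ih => exact ih.trans (hstep.topConj_presented b₁.isSMB b₂.isSMB)

section Presented

variable {S : Type} {Λ : Set (ℤ → S)} {M : SMBData S S} {e : ∀ l, Fin (M.m l) → Set (List S)}

theorem IsClassPresentation.exists_of_admissible (h : IsClassPresentation Λ M e) (x : ℤ → S)
    (n : ℕ) (a : ℤ) (l : ℕ) (i : Fin (M.m l)) (hi : Admissible M x n a l i) (u : List S)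
    (hu : u ∈ e l i) : ∃ z ∈ Λ, readWord z 0 l = u ∧ readWord z l n = readWord x a n := by
  induction n generalizing a l u with
  | zero =>
    obtain ⟨z, -, hz⟩ := (h.enum l).mem i
    rw [hz] at hu
    obtain ⟨z', hz', -, hw⟩ := hu
    exact ⟨z', hz', hw, rfl⟩
  | succ n ih =>
    obtain ⟨j, hj, hadm⟩ := hi
    rw [((h.plus l).2 i j (x a)).1 hj] at hu
    obtain ⟨z, hz, h1, h2⟩ := ih _ _ j hadm (u ++ [x a]) hu
    rw [readWord_succ', zero_add] at h1
    obtain ⟨h3, h4⟩ := List.append_inj' h1 rfl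
    refine ⟨z, hz, h3, ?_⟩
    rw [Nat.cast_succ] at h2
    simp only [readWord, h2, (List.cons.inj h4).1]

theorem IsClassPresentation.admissible_of_mem (h : IsClassPresentation Λ M e)
    (hΛ : ShiftInv 1 Λ) {x : ℤ → S} (hx : x ∈ Λ) (n : ℕ) (a : ℤ) (l : ℕ) (i : Fin (M.m l))
    (hi : e l i = fillings Λ x (a - l) l) : Admissible M x n a l i := by
  induction n generalizing a l with
  | zero => trivial
  | succ n ih =>
    obtain ⟨j, hj⟩ := (h.enum (l + 1)).exists (W := fillings Λ x (a - l) (l + 1))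
      (by rw [centralClasses_congr hΛ 0 (a - l)]; exact ⟨x, hx, rfl⟩)
    have hr := rq_fillings Λ (AgreeOff.refl x (a - l) (l + 1))
    rw [sub_add_cancel] at hr
    refine ⟨j, ((h.plus l).2 i j (x a)).2 (by rw [hi, hj, hr]), ih _ _ j ?_⟩
    rw [hj]
    congr 1
    push_cast
    ring

theorem IsClassPresentation.presented_eq [TopologicalSpace S] (h : IsClassPresentation Λ M e)
    (hΛ : ShiftInv 1 Λ) (hcl : IsClosed Λ) : presented M = Λ := by
  ext x
  constructor
  · intro hx
    have key : ∀ n : ℕ, ∃ w ∈ Λ, ∀ i : ℤ, -n ≤ i → i ≤ n → w i = x i := by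
      intro n
      obtain ⟨l, i, hi⟩ := hx (-n) (2 * n + 1)
      obtain ⟨u, hu⟩ := h.nonempty l i
      obtain ⟨z, hz, -, hw⟩ := h.exists_of_admissible x _ _ l i hi u hu
      refine ⟨shiftZ (l + n) z, (hΛ.all _ z).2 hz, fun k h1 h2 => ?_⟩
      rw [readWord_eq_iff] at hw
      have := hw (k + n).toNat (by omega)
      rw [Int.toNat_of_nonneg (by omega)] at this
      simp only [shiftZ]
      convert this using 2 <;> ring
    choose w hw hwx using key
    refine hcl.mem_of_tendsto (b := Filter.atTop) (f := w) ?_ (Filter.Eventually.of_forall hw)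
    rw [tendsto_pi_nhds]
    intro i
    refine tendsto_const_nhds.congr' ?_
    filter_upwards [Filter.eventually_ge_atTop i.natAbs] with n hn
    exact (hwx n i (by omega) (by omega)).symm
  · intro hx a n
    obtain ⟨i, hi⟩ := (h.enum 0).exists (W := fillings Λ x (a - (0 : ℕ)) 0)
      (by rw [centralClasses_congr hΛ 0 (a - (0 : ℕ))]; exact ⟨x, hx, rfl⟩)
    exact ⟨0, i, h.admissible_of_mem hΛ hx n a 0 i hi⟩

end Presented

/-- two nonempty subshifts over finite alphabets are topologically
conjugate if and only if their canonical symbolic matrix bisystems (the matrix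
presentations of their canonical λ-graph bisystems) are properly strong shift
equivalent. -/
theorem stmt_6 {A B : Type} [Finite A] [Finite B]
    [TopologicalSpace A] [DiscreteTopology A] [TopologicalSpace B] [DiscreteTopology B]
    (Λ₁ : Set (ℤ → A)) (Λ₂ : Set (ℤ → B))
    (h1 : IsSubshift Λ₁) (h2 : IsSubshift Λ₂) (hne1 : Λ₁.Nonempty) (hne2 : Λ₂.Nonempty)
    (M : SMBData A A) (N : SMBData B B)
    (hM : Presents M (canonicalLGBS Λ₁)) (hN : Presents N (canonicalLGBS Λ₂))
    (hMs : IsSMB M) (hMf : M.FPCC) (hNs : IsSMB N) (hNf : N.FPCC) :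
    TopConj Λ₁ Λ₂ ↔ ProperlySSE ⟨A, M, hMs, hMf⟩ ⟨B, N, hNs, hNf⟩ := by
  obtain ⟨e, he⟩ := hM.exists_isClassPresentation h1.shiftInv
  obtain ⟨e', he'⟩ := hN.exists_isClassPresentation h2.shiftInv
  constructor
  · exact fun h => h.presentationsSSE h1 h2 hne1 M N e e' he he' hMs hMf hNs hNf
  · intro h
    have h' := h.topConj_presented
    rw [he.presented_eq h1.shiftInv h1.1, he'.presented_eq h2.shiftInv h2.1] at h'
    rwa [DiscreteTopology.eq_bot (α := A), DiscreteTopology.eq_bot (α := B)]
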